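/- arXiv:2412.19644 — 2 statements merged into one kernel-verified Lean document; each statement's English description precedes it below -/
import Mathlib

section
/- Let m ∈ ℕ and z ≥ l > 0, and define C_{m,l,z} := Σ_{l/2 ≤ d < l, (d,m)=1} 1/φ(d) − Σ_{z/2 < d ≤ z, (d,m)=1} 1/φ(d), where d runs over natural numbers and φ is Euler's totient. Then |C_{m,l,z}| ≪ min{ 1, τ(m) · log(l+2)/(l+2) }, with an absolute implied constant, where τ(m) is the number of divisors of m. -/
open scoped Classical

/-- `τ(n)`: the number of divisors of `n`. -/
def tau (n : ℕ) : ℕ := n.divisors.card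

/-- `C_{m,l,z} := Σ_{l/2 ≤ d < l, (d,m)=1} 1/φ(d) − Σ_{z/2 < d ≤ z, (d,m)=1} 1/φ(d)`,
the sums being over natural numbers `d`. -/
noncomputable def Cmlz (m : ℕ) (l z : ℝ) : ℝ :=
  (∑ d ∈ (Finset.Icc 1 ⌈l⌉₊).filter
      (fun d : ℕ => l / 2 ≤ (d : ℝ) ∧ (d : ℝ) < l ∧ Nat.Coprime d m), 1 / (Nat.totient d : ℝ)) -
  (∑ d ∈ (Finset.Icc 1 ⌈z⌉₊).filter
      (fun d : ℕ => z / 2 < (d : ℝ) ∧ (d : ℝ) ≤ z ∧ Nat.Coprime d m), 1 / (Nat.totient d : ℝ))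

open Finset ArithmeticFunction

/-- Summing over the multiples of `k`. -/
lemma sum_ite_dvd {N k : ℕ} (hk : 1 ≤ k) {F : ℕ → ℝ} (hF : ∀ d, N < d → F d = 0) :
    ∑ d ∈ Icc 1 N, (if k ∣ d then F d else 0) = ∑ e ∈ Icc 1 N, F (k * e) := by
  have hsub : ∑ e ∈ Icc 1 N with k * e ≤ N, F (k * e) = ∑ e ∈ Icc 1 N, F (k * e) := by
    refine sum_subset (filter_subset _ _) fun e he hne => hF _ ?_
    by_contra h
    exact hne (mem_filter.2 ⟨he, not_lt.1 h⟩)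
  rw [← hsub, ← sum_filter]
  refine sum_nbij' (fun d => d / k) (fun e => k * e) ?_ ?_ ?_ ?_ ?_
  · intro d hd
    simp only [mem_filter, mem_Icc] at hd ⊢
    obtain ⟨⟨h1, h2⟩, c, rfl⟩ := hd
    rw [Nat.mul_div_cancel_left _ hk]
    have hc : 1 ≤ c := Nat.pos_of_mul_pos_left h1
    exact ⟨⟨hc, (Nat.le_mul_of_pos_left c hk).trans h2⟩, h2⟩
  · intro e he
    simp only [mem_filter, mem_Icc] at he ⊢
    exact ⟨⟨Nat.mul_pos hk he.1.1, he.2⟩, dvd_mul_right _ _⟩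
  · intro d hd
    exact Nat.mul_div_cancel' (mem_filter.1 hd).2
  · intro e _
    exact Nat.mul_div_cancel_left _ hk
  · intro d hd
    simp only [Nat.mul_div_cancel' (mem_filter.1 hd).2]

/-- The arithmetic function `n ↦ 1 / φ(n)`. -/
noncomputable def invTotient : ArithmeticFunction ℝ :=
  ⟨fun n => ((Nat.totient n : ℕ) : ℝ)⁻¹, by simp⟩

lemma invTotient_apply (n : ℕ) : invTotient n = ((Nat.totient n : ℕ) : ℝ)⁻¹ := rfl

lemma isMultiplicative_invTotient : invTotient.IsMultiplicative := by
  refine ⟨by simp [invTotient_apply], fun {m n} h => ?_⟩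
  simp [invTotient_apply, Nat.totient_mul h, mul_comm]

/-- The arithmetic function `n ↦ 1 / (n φ(n))`. -/
noncomputable def invMulTotient : ArithmeticFunction ℝ :=
  ⟨fun n => ((n : ℝ) * (Nat.totient n : ℕ))⁻¹, by simp⟩

lemma invMulTotient_apply (n : ℕ) : invMulTotient n = ((n : ℝ) * (Nat.totient n : ℕ))⁻¹ := rfl

lemma isMultiplicative_invMulTotient : invMulTotient.IsMultiplicative := by
  refine ⟨by simp [invMulTotient_apply], fun {m n} h => ?_⟩
  simp only [invMulTotient_apply, Nat.totient_mul h]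
  push_cast
  rw [← mul_inv]
  congr 1
  ring

/-- The function `c(n) = μ²(n) / (n φ(n))`, for which `1/φ(n) = ∑_{k ∣ n} (k/n) c(k)`. -/
noncomputable def totientWeight (n : ℕ) : ℝ := if Squarefree n then invMulTotient n else 0

lemma totientWeight_nonneg (n : ℕ) : 0 ≤ totientWeight n := by
  unfold totientWeight
  split_ifs
  · rw [invMulTotient_apply]; positivity
  · exact le_rfl

lemma totientWeight_le (n : ℕ) : totientWeight n ≤ ((n : ℝ) * (Nat.totient n : ℕ))⁻¹ := by
  unfold totientWeight
  split_ifs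
  · exact le_rfl
  · positivity

lemma dvd_prod_primeFactors_iff {k d : ℕ} (hd : d ≠ 0) :
    k ∣ ∏ p ∈ d.primeFactors, p ↔ Squarefree k ∧ k ∣ d := by
  have hsq : Squarefree (∏ p ∈ d.primeFactors, p) := by
    have h := UniqueFactorizationMonoid.squarefree_radical (a := d)
    rwa [Nat.radical_eq_prod_primeFactors] at h
  constructor
  · intro h
    exact ⟨hsq.squarefree_of_dvd h, h.trans (Nat.prod_primeFactors_dvd d)⟩
  · rintro ⟨hk, hkd⟩
    rw [← Nat.prod_primeFactors_of_squarefree hk]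
    exact prod_dvd_prod_of_subset _ _ _ (Nat.primeFactors_mono hkd hd)

lemma inv_totient_eq_sum {d N : ℕ} (hd : d ∈ Icc 1 N) :
    1 / ((Nat.totient d : ℕ) : ℝ) =
      ∑ k ∈ Icc 1 N, if k ∣ d then (k : ℝ) * totientWeight k * (1 / d) else 0 := by
  obtain ⟨h1, h2⟩ := mem_Icc.1 hd
  have hd0 : d ≠ 0 := by omega
  have hsq : Squarefree (∏ p ∈ d.primeFactors, p) :=
    ((dvd_prod_primeFactors_iff hd0).1 dvd_rfl).1
  have hpf : (∏ p ∈ d.primeFactors, p).primeFactors = d.primeFactors :=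
    Nat.primeFactors_prod fun p hp => Nat.prime_of_mem_primeFactors hp
  have key := isMultiplicative_invTotient.prodPrimeFactors_one_add_of_squarefree hsq
  rw [hpf] at key
  have hsum : ∑ k ∈ (∏ p ∈ d.primeFactors, p).divisors, invTotient k =
      ∑ k ∈ Icc 1 N, if k ∣ d then (k : ℝ) * totientWeight k else 0 := by
    have hset : (∏ p ∈ d.primeFactors, p).divisors =
        {k ∈ Icc 1 N | Squarefree k ∧ k ∣ d} := by
      ext k
      simp only [Nat.mem_divisors, mem_filter, mem_Icc, dvd_prod_primeFactors_iff hd0]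
      constructor
      · rintro ⟨⟨hs, hk⟩, _⟩
        exact ⟨⟨Nat.pos_of_dvd_of_pos hk h1, (Nat.le_of_dvd h1 hk).trans h2⟩, hs, hk⟩
      · rintro ⟨_, hs⟩
        exact ⟨hs, hsq.ne_zero⟩
    rw [hset, sum_filter]
    refine sum_congr rfl fun k hk => ?_
    have hk0 : (k : ℝ) ≠ 0 := by
      have := (mem_Icc.1 hk).1
      positivity
    by_cases hs : Squarefree k <;> by_cases hkd : k ∣ d <;>
      simp [hs, hkd, totientWeight, invTotient_apply, invMulTotient_apply]
    field_simp
  have hprod : ∏ p ∈ d.primeFactors, (1 + invTotient p) = (d : ℝ) / (Nat.totient d : ℕ) := by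
    have ht : ((Nat.totient d : ℕ) : ℝ) = d * ∏ p ∈ d.primeFactors, (1 - (p : ℝ)⁻¹) := by
      have h : (((Nat.totient d : ℕ) : ℚ) : ℝ) =
          ((d * ∏ p ∈ d.primeFactors, (1 - (p : ℚ)⁻¹) : ℚ) : ℝ) := by
        rw [Nat.totient_eq_mul_prod_factors d]
      push_cast at h
      exact h
    have hd' : (d : ℝ) ≠ 0 := by exact_mod_cast hd0
    rw [ht, ← div_div, div_self hd', one_div, ← prod_inv_distrib]
    refine prod_congr rfl fun p hp => ?_
    have hp' := Nat.prime_of_mem_primeFactors hp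
    have hp2 : (2 : ℝ) ≤ p := by exact_mod_cast hp'.two_le
    rw [invTotient_apply, Nat.totient_prime hp', Nat.cast_pred hp'.pos]
    have h3 : (p : ℝ) - 1 ≠ 0 := by linarith
    have h4 : (p : ℝ) ≠ 0 := by linarith
    have h5 : 1 - (p : ℝ)⁻¹ ≠ 0 := by
      have : 1 - (p : ℝ)⁻¹ = (p - 1) / p := by field_simp
      rw [this]; positivity
    field_simp
    ring
  have hd' : (d : ℝ) ≠ 0 := by exact_mod_cast hd0
  have hfin : 1 / ((Nat.totient d : ℕ) : ℝ) = (d : ℝ) / (Nat.totient d : ℕ) * (1 / d) := by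
    field_simp
  rw [hfin, ← hprod, key, hsum, sum_mul]
  exact sum_congr rfl fun k _ => by split_ifs <;> simp

/-- Unfolding `1/φ` in a sum against a function supported on `[1, N]`. -/
lemma sum_div_totient {N : ℕ} {F : ℕ → ℝ} (hF : ∀ d, N < d → F d = 0) :
    ∑ d ∈ Icc 1 N, F d * (1 / ((Nat.totient d : ℕ) : ℝ)) =
      ∑ k ∈ Icc 1 N, totientWeight k * ∑ e ∈ Icc 1 N, F (k * e) / e := by
  have h1 : ∀ d ∈ Icc 1 N, F d * (1 / ((Nat.totient d : ℕ) : ℝ)) =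
      ∑ k ∈ Icc 1 N, if k ∣ d then F d * ((k : ℝ) * totientWeight k * (1 / d)) else 0 := by
    intro d hd
    rw [inv_totient_eq_sum hd, mul_sum]
    exact sum_congr rfl fun k _ => by split_ifs <;> simp
  rw [sum_congr rfl h1, sum_comm]
  refine sum_congr rfl fun k hk => ?_
  have hk1 := (mem_Icc.1 hk).1
  rw [sum_ite_dvd (F := fun d => F d * ((k : ℝ) * totientWeight k * (1 / d))) hk1
    (fun d hd => by simp [hF d hd]), mul_sum]
  refine sum_congr rfl fun e he => ?_
  have he1 := (mem_Icc.1 he).1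
  have : (k : ℝ) ≠ 0 := by positivity
  have : (e : ℝ) ≠ 0 := by positivity
  push_cast
  field_simp

lemma sum_totientWeight_le (N : ℕ) : ∑ k ∈ Icc 1 N, totientWeight k ≤ 3 := by
  have hle : ∑ k ∈ Icc 1 N, totientWeight k ≤
      ∏ p ∈ (primorial N).primeFactors, (1 + invMulTotient p) := by
    rw [isMultiplicative_invMulTotient.prodPrimeFactors_one_add_of_squarefree
      (squarefree_primorial N)]
    unfold totientWeight
    rw [← sum_filter]
    refine sum_le_sum_of_subset_of_nonneg (fun k hk => ?_) fun k _ _ => ?_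
    · simp only [mem_filter, mem_Icc] at hk
      rw [Nat.mem_divisors]
      refine ⟨?_, (primorial_pos N).ne'⟩
      rw [← Nat.prod_primeFactors_of_squarefree hk.2]
      refine prod_dvd_prod_of_subset _ _ _ fun p hp => ?_
      have := Nat.le_of_mem_primeFactors hp
      simp only [mem_filter, mem_range]
      exact ⟨by omega, Nat.prime_of_mem_primeFactors hp⟩
    · rw [invMulTotient_apply]; positivity
  have htel : ∀ n : ℕ, ∑ p ∈ Icc 2 (n + 1), ((p : ℝ) * (p - 1))⁻¹ = 1 - 1 / ((n : ℝ) + 1) := by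
    intro n
    induction n with
    | zero => simp
    | succ n ih =>
      rw [sum_Icc_succ_top (by omega), ih]
      push_cast
      have : (n : ℝ) + 1 ≠ 0 := by positivity
      have : (n : ℝ) + 1 + 1 ≠ 0 := by positivity
      have h3 : (n : ℝ) + 1 + 1 - 1 = n + 1 := by ring
      rw [h3]
      field_simp
      ring
  have hsum : ∑ p ∈ (primorial N).primeFactors, invMulTotient p ≤ 1 := by
    calc ∑ p ∈ (primorial N).primeFactors, invMulTotient p
        = ∑ p ∈ (primorial N).primeFactors, ((p : ℝ) * (p - 1))⁻¹ := by
          refine sum_congr rfl fun p hp => ?_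
          have hp' := Nat.prime_of_mem_primeFactors hp
          rw [invMulTotient_apply, Nat.totient_prime hp', Nat.cast_pred hp'.pos]
      _ ≤ ∑ p ∈ Icc 2 (N + 1), ((p : ℝ) * (p - 1))⁻¹ := by
          refine sum_le_sum_of_subset_of_nonneg (fun p hp => ?_) fun p hp _ => ?_
          · have hp' := Nat.prime_of_mem_primeFactors hp
            rw [primeFactors_primorial] at hp
            have := Nat.le_of_mem_primesLE hp
            exact mem_Icc.2 ⟨hp'.two_le, by omega⟩
          · have : (2 : ℝ) ≤ p := by exact_mod_cast (mem_Icc.1 hp).1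
            have : (0 : ℝ) ≤ p - 1 := by linarith
            positivity
      _ ≤ 1 := by
          rw [htel]
          have : 0 ≤ 1 / ((N : ℝ) + 1) := by positivity
          linarith
  calc ∑ k ∈ Icc 1 N, totientWeight k
      ≤ ∏ p ∈ (primorial N).primeFactors, (1 + invMulTotient p) := hle
    _ ≤ Real.exp (∑ p ∈ (primorial N).primeFactors, invMulTotient p) :=
        Real.prod_one_add_le_exp_sum _ fun p => by
          rw [invMulTotient_apply]; positivity
    _ ≤ Real.exp 1 := Real.exp_le_exp.2 hsum
    _ ≤ 3 := Real.exp_one_lt_three.le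

lemma sum_inv_totient_le {l : ℝ} (hl : 1 ≤ l) :
    ∑ k ∈ Icc 1 ⌊l⌋₊, 1 / ((Nat.totient k : ℕ) : ℝ) ≤ 3 * (1 + Real.log l) := by
  set N := ⌊l⌋₊
  have hlog : 0 ≤ Real.log l := Real.log_nonneg hl
  have hF : ∀ d, N < d → (if d ≤ N then (1 : ℝ) else 0) = 0 := fun d hd => by
    simp [not_le.2 hd]
  have h0 : ∑ k ∈ Icc 1 N, 1 / ((Nat.totient k : ℕ) : ℝ) =
      ∑ k ∈ Icc 1 N, (if k ≤ N then (1 : ℝ) else 0) * (1 / ((Nat.totient k : ℕ) : ℝ)) :=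
    sum_congr rfl fun k hk => by simp [(mem_Icc.1 hk).2]
  rw [h0, sum_div_totient hF]
  have hh : ∑ e ∈ Icc 1 N, (1 : ℝ) / e ≤ 1 + Real.log l := by
    have h := harmonic_floor_le_one_add_log l hl
    rw [harmonic_eq_sum_Icc] at h
    push_cast at h
    simpa using h
  calc _ ≤ ∑ k ∈ Icc 1 N, totientWeight k * (1 + Real.log l) := by
        refine sum_le_sum fun k _ => mul_le_mul_of_nonneg_left ?_ (totientWeight_nonneg k)
        refine le_trans (sum_le_sum fun e _ => ?_) hh
        gcongr
        split_ifs <;> norm_num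
    _ = (∑ k ∈ Icc 1 N, totientWeight k) * (1 + Real.log l) := by rw [sum_mul]
    _ ≤ _ := mul_le_mul_of_nonneg_right (sum_totientWeight_le N) (by linarith)

lemma sum_inv_sq_tail_le {y : ℝ} (hy : 0 < y) (N : ℕ) :
    ∑ e ∈ Icc 1 N, (if y < e then 1 / (e : ℝ) ^ 2 else 0) ≤ 2 / y := by
  rw [← sum_filter]
  calc ∑ e ∈ Icc 1 N with y < (e : ℕ), 1 / (e : ℝ) ^ 2
      ≤ ∑ e ∈ Ioo ⌊y⌋₊ (N + 1), ((e : ℝ) ^ 2)⁻¹ := by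
        simp only [one_div]
        refine sum_le_sum_of_subset_of_nonneg (fun e he => ?_) fun e _ _ => by positivity
        simp only [mem_filter, mem_Icc] at he
        exact mem_Ioo.2 ⟨(Nat.floor_lt hy.le).2 he.2, by omega⟩
    _ ≤ 2 / ((⌊y⌋₊ : ℝ) + 1) := sum_Ioo_inv_sq_le _ _
    _ ≤ 2 / y := by
        gcongr
        exact (Nat.lt_floor_add_one y).le

lemma sum_totientWeight_tail_le {l : ℝ} (hl : 0 < l) (N : ℕ) :
    ∑ k ∈ Icc 1 N, (if l < k then totientWeight k else 0) ≤ 6 / l := by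
  set F : ℕ → ℝ := fun d => if l < d ∧ d ≤ N then 1 / (d : ℝ) else 0 with hFdef
  have hF : ∀ d, N < d → F d = 0 := fun d hd => by simp [hFdef, not_le.2 hd]
  calc ∑ k ∈ Icc 1 N, (if l < k then totientWeight k else 0)
      ≤ ∑ k ∈ Icc 1 N, F k * (1 / ((Nat.totient k : ℕ) : ℝ)) := by
        refine sum_le_sum fun k hk => ?_
        by_cases h : l < k
        · simp only [hFdef, h, (mem_Icc.1 hk).2, if_true, and_self]
          refine (totientWeight_le k).trans_eq ?_
          simp [mul_comm]
        · simp [hFdef, h]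
    _ = ∑ k ∈ Icc 1 N, totientWeight k * ∑ e ∈ Icc 1 N, F (k * e) / e := sum_div_totient hF
    _ ≤ ∑ k ∈ Icc 1 N, totientWeight k * (2 / l) := by
        refine sum_le_sum fun k hk => mul_le_mul_of_nonneg_left ?_ (totientWeight_nonneg k)
        have hk1 : (0 : ℝ) < k := by exact_mod_cast (mem_Icc.1 hk).1
        calc ∑ e ∈ Icc 1 N, F (k * e) / e
            ≤ ∑ e ∈ Icc 1 N, 1 / (k : ℝ) * (if l / k < e then 1 / (e : ℝ) ^ 2 else 0) := by
              refine sum_le_sum fun e he => ?_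
              have he1 : (0 : ℝ) < e := by exact_mod_cast (mem_Icc.1 he).1
              by_cases h : l / k < e
              · have hle : F (k * e) ≤ 1 / ((k : ℝ) * e) := by
                  simp only [hFdef]
                  push_cast
                  split_ifs
                  · exact le_rfl
                  · positivity
                calc F (k * e) / e ≤ 1 / ((k : ℝ) * e) / e := by gcongr
                  _ = _ := by rw [if_pos h]; field_simp
              · have h' : ¬ l < (k : ℝ) * e := by
                  rwa [div_lt_iff₀ hk1, mul_comm] at h
                simp [hFdef, h, h']
          _ ≤ 1 / (k : ℝ) * (2 / (l / k)) := by
              rw [← mul_sum]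
              exact mul_le_mul_of_nonneg_left (sum_inv_sq_tail_le (by positivity) N)
                (by positivity)
          _ = 2 / l := by field_simp
    _ = (∑ k ∈ Icc 1 N, totientWeight k) * (2 / l) := by rw [sum_mul]
    _ ≤ 3 * (2 / l) := mul_le_mul_of_nonneg_right (sum_totientWeight_le N) (by positivity)
    _ = 6 / l := by ring

/-- A weight on `ℕ` that agrees with the indicator function of the interval from `x/2` to `x`,
with no condition at the endpoints. -/
structure IsDyadicWeight (x : ℝ) (F : ℕ → ℝ) : Prop where
  nonneg : ∀ d, 0 ≤ F d
  le_one : ∀ d, F d ≤ 1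
  eq_one : ∀ d : ℕ, x / 2 < d → d < x → F d = 1
  eq_zero_of_lt : ∀ d : ℕ, (d : ℝ) < x / 2 → F d = 0
  eq_zero_of_gt : ∀ d : ℕ, x < d → F d = 0

lemma IsDyadicWeight.comp_mul {x : ℝ} {F : ℕ → ℝ} (hF : IsDyadicWeight x F) {k : ℕ}
    (hk : 1 ≤ k) : IsDyadicWeight (x / k) (fun e => F (k * e)) := by
  have hk' : (0 : ℝ) < k := by exact_mod_cast hk
  refine ⟨fun d => hF.nonneg _, fun d => hF.le_one _, fun d h1 h2 => hF.eq_one _ ?_ ?_,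
    fun d h => hF.eq_zero_of_lt _ ?_, fun d h => hF.eq_zero_of_gt _ ?_⟩
  · rw [div_right_comm, div_lt_iff₀ hk'] at h1
    push_cast
    linarith
  · rw [lt_div_iff₀ hk'] at h2
    push_cast
    linarith
  · rw [div_right_comm, lt_div_iff₀ hk'] at h
    push_cast
    linarith
  · rw [div_lt_iff₀ hk'] at h
    push_cast
    linarith

lemma abs_harmonic_floor_sub_le {x : ℝ} (hx : 1 ≤ x) :
    |(harmonic ⌊x⌋₊ : ℝ) - Real.log x - Real.eulerMascheroniConstant| ≤ 2 / x := by
  set n := ⌊x⌋₊ with hn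
  have hn1 : 1 ≤ n := Nat.le_floor (by exact_mod_cast hx)
  have hn0 : (0 : ℝ) < n := by exact_mod_cast hn1
  have hn1' : (1 : ℝ) ≤ n := by exact_mod_cast hn1
  have hnx : (n : ℝ) ≤ x := Nat.floor_le (by linarith)
  have hxn : x < n + 1 := Nat.lt_floor_add_one x
  have h1 := Real.eulerMascheroniSeq_lt_eulerMascheroniConstant n
  have h2 := Real.eulerMascheroniConstant_lt_eulerMascheroniSeq' n
  rw [Real.eulerMascheroniSeq] at h1
  rw [Real.eulerMascheroniSeq', if_neg (by omega)] at h2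
  have h3 : Real.log n ≤ Real.log x := Real.log_le_log hn0 hnx
  have h4 : Real.log x ≤ Real.log (n + 1) := Real.log_le_log (by linarith) hxn.le
  have h5 : Real.log (n + 1) - Real.log n ≤ 1 / n := by
    rw [← Real.log_div (by positivity) (by positivity)]
    refine (Real.log_le_sub_one_of_pos (by positivity)).trans_eq ?_
    field_simp
    ring
  have h6 : 1 / (n : ℝ) ≤ 2 / x := by
    rw [div_le_div_iff₀ hn0 (by linarith)]
    linarith
  rw [abs_le]
  constructor <;> linarith

lemma abs_sum_Ioc_inv_sub_log_two_le {x : ℝ} (hx : 0 < x) :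
    |∑ g ∈ Ioc ⌊x / 2⌋₊ ⌊x⌋₊, 1 / (g : ℝ) - Real.log 2| ≤ 6 / x := by
  have hlog := Real.log_two_lt_d9
  have hlog' := Real.log_two_gt_d9
  have hmono : ⌊x / 2⌋₊ ≤ ⌊x⌋₊ := Nat.floor_mono (by linarith)
  rcases le_or_gt 2 x with h | h
  · have hsum : ∑ g ∈ Ioc ⌊x / 2⌋₊ ⌊x⌋₊, 1 / (g : ℝ) =
        (harmonic ⌊x⌋₊ : ℝ) - (harmonic ⌊x / 2⌋₊ : ℝ) := by
      have e : ∀ n : ℕ, (harmonic n : ℝ) = ∑ g ∈ Ioc 0 n, 1 / (g : ℝ) := by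
        intro n
        rw [harmonic_eq_sum_Icc]
        push_cast
        simp only [one_div]
        rfl
      rw [e, e, ← sum_Ioc_consecutive _ (Nat.zero_le _) hmono]
      ring
    have h1 := abs_harmonic_floor_sub_le (x := x) (by linarith)
    have h2 := abs_harmonic_floor_sub_le (x := x / 2) (by linarith)
    rw [Real.log_div (by linarith) (by norm_num)] at h2
    have h3 : 2 / (x / 2) = 4 / x := by field_simp; norm_num
    rw [h3] at h2
    have h4 : 6 / x = 2 / x + 4 / x := by ring
    rw [hsum, h4]
    rw [abs_le] at h1 h2 ⊢
    constructor <;> linarith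
  · have hx2 : 1 ≤ 6 / x := by rw [le_div_iff₀ hx]; linarith
    have h0 : ⌊x / 2⌋₊ = 0 := Nat.floor_eq_zero.2 (by linarith)
    have h1 : ⌊x⌋₊ < 2 := (Nat.floor_lt hx.le).2 (by exact_mod_cast h)
    rw [h0]
    refine le_trans ?_ hx2
    interval_cases ⌊x⌋₊
    · simp only [Ioc_self, sum_empty]
      rw [abs_le]; constructor <;> linarith
    · have : Ioc 0 1 = ({1} : Finset ℕ) := rfl
      rw [this, sum_singleton, abs_le]
      constructor <;> norm_num <;> linarith

lemma sum_ite_eq_inv_le {y : ℝ} (hy : 0 < y) (N : ℕ) :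
    ∑ g ∈ Icc 1 N, (if (g : ℝ) = y then 1 / (g : ℝ) else 0) ≤ 1 / y := by
  by_cases h : ∃ n : ℕ, (n : ℝ) = y
  · obtain ⟨n, rfl⟩ := h
    simp only [Nat.cast_inj, sum_ite_eq']
    split_ifs
    · exact le_rfl
    · positivity
  · push Not at h
    rw [sum_eq_zero fun g _ => if_neg (h g)]
    positivity

lemma IsDyadicWeight.abs_sum_sub_log_two_le {x : ℝ} {F : ℕ → ℝ} (hF : IsDyadicWeight x F)
    (hx : 0 < x) {N : ℕ} (hN : x ≤ N) :
    |∑ g ∈ Icc 1 N, F g / g - Real.log 2| ≤ 10 / x := by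
  set G : ℕ → ℝ := fun g => if x / 2 < g ∧ (g : ℝ) ≤ x then 1 else 0 with hG
  have hGsum : ∑ g ∈ Icc 1 N, G g / g = ∑ g ∈ Ioc ⌊x / 2⌋₊ ⌊x⌋₊, 1 / (g : ℝ) := by
    have hset : Ioc ⌊x / 2⌋₊ ⌊x⌋₊ = {g ∈ Icc 1 N | x / 2 < (g : ℕ) ∧ ((g : ℕ) : ℝ) ≤ x} := by
      ext g
      simp only [mem_Ioc, mem_filter, mem_Icc]
      rw [Nat.floor_lt (by positivity), Nat.le_floor_iff hx.le]
      refine ⟨fun h => ⟨⟨?_, ?_⟩, h⟩, fun h => h.2⟩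
      · have : (0 : ℝ) < g := lt_trans (by positivity) h.1
        exact_mod_cast this
      · exact_mod_cast h.2.trans hN
    rw [hset, sum_filter]
    refine sum_congr rfl fun g _ => ?_
    simp only [hG]
    split_ifs <;> simp
  have hdiff : |∑ g ∈ Icc 1 N, F g / g - ∑ g ∈ Icc 1 N, G g / g| ≤ 1 / (x / 2) + 1 / x := by
    rw [← sum_sub_distrib]
    refine (abs_sum_le_sum_abs _ _).trans ?_
    refine le_trans ?_ (add_le_add (sum_ite_eq_inv_le (half_pos hx) N) (sum_ite_eq_inv_le hx N))
    rw [← sum_add_distrib]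
    refine sum_le_sum fun g _ => ?_
    have h0 := hF.nonneg g
    have h1 := hF.le_one g
    have hcases : |F g - G g| ≤
        (if (g : ℝ) = x / 2 then 1 else 0) + (if (g : ℝ) = x then 1 else 0) := by
      rcases lt_trichotomy (g : ℝ) (x / 2) with h | h | h
      · have : ¬ x / 2 < g := h.not_gt
        have h3 : (g : ℝ) ≠ x := by intro h'; linarith
        simp [hG, this, hF.eq_zero_of_lt g h, h.ne, h3]
      · have h3 : ¬ (g : ℝ) = x := by intro h'; linarith
        have : ¬ x / 2 < g := h.not_gt
        simp only [hG, this, false_and, if_false, if_pos h, if_neg h3]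
        rw [abs_le]; constructor <;> linarith
      · rcases lt_trichotomy (g : ℝ) x with h' | h' | h'
        · simp [hG, h, h'.le, hF.eq_one g h h', h.ne', h'.ne]
        · simp only [hG, h, h'.le, and_self, if_true, if_neg h.ne', if_pos h']
          rw [abs_le]; constructor <;> linarith
        · have : ¬ (g : ℝ) ≤ x := not_le.2 h'
          simp [hG, this, hF.eq_zero_of_gt g h', h.ne', h'.ne']
    rw [← sub_div, abs_div, Nat.abs_cast]
    calc |F g - G g| / (g : ℝ) ≤
        ((if (g : ℝ) = x / 2 then 1 else 0) + (if (g : ℝ) = x then 1 else 0)) / (g : ℝ) := by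
          gcongr
      _ = _ := by rw [add_div]; split_ifs <;> simp
  have h1 := abs_sum_Ioc_inv_sub_log_two_le hx
  rw [← hGsum] at h1
  have h2 : 1 / (x / 2) + 1 / x = 3 / x := by field_simp; norm_num
  have h3 : 10 / x = 6 / x + 3 / x + 1 / x := by ring
  have h4 : 0 < 1 / x := by positivity
  rw [h2] at hdiff
  rw [h3]
  rw [abs_le] at h1 hdiff ⊢
  constructor <;> linarith

lemma IsDyadicWeight.sum_le {x : ℝ} {F : ℕ → ℝ} (hF : IsDyadicWeight x F)
    (hx : 0 < x) {N : ℕ} (hN : x ≤ N) :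
    ∑ g ∈ Icc 1 N, F g / g ≤ 11 := by
  rcases lt_or_ge x 1 with h | h
  · rw [sum_eq_zero]
    · norm_num
    · intro g hg
      have : (1 : ℝ) ≤ g := by exact_mod_cast (mem_Icc.1 hg).1
      rw [hF.eq_zero_of_gt g (by linarith), zero_div]
  · have h1 := (abs_le.1 (hF.abs_sum_sub_log_two_le hx hN)).2
    have h2 : 10 / x ≤ 10 := div_le_self (by norm_num) h
    have := Real.log_two_lt_d9
    linarith

/-- The indicator function of coprimality to `m`. -/
noncomputable def coprimeInd (m d : ℕ) : ℝ := if Nat.Coprime d m then 1 else 0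

lemma coprimeInd_nonneg (m d : ℕ) : 0 ≤ coprimeInd m d := by
  unfold coprimeInd; split_ifs <;> norm_num

lemma coprimeInd_le_one (m d : ℕ) : coprimeInd m d ≤ 1 := by
  unfold coprimeInd; split_ifs <;> norm_num

lemma coprimeInd_mul (m k e : ℕ) : coprimeInd m (k * e) = coprimeInd m k * coprimeInd m e := by
  unfold coprimeInd
  simp only [Nat.coprime_mul_iff_left]
  split_ifs <;> simp_all

lemma coprimeInd_eq_sum {m : ℕ} (hm : 1 ≤ m) (d : ℕ) :
    coprimeInd m d = ∑ f ∈ m.divisors, if f ∣ d then (moebius f : ℝ) else 0 := by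
  have h := congrArg (fun a : ArithmeticFunction ℤ => a (Nat.gcd d m)) moebius_mul_coe_zeta
  simp only [coe_mul_zeta_apply, one_apply] at h
  have hset : (Nat.gcd d m).divisors = {f ∈ m.divisors | f ∣ d} := by
    ext f
    have hg : Nat.gcd d m ≠ 0 := (Nat.gcd_pos_of_pos_right d hm).ne'
    have hm0 : m ≠ 0 := by omega
    simp only [Nat.mem_divisors, mem_filter, Nat.dvd_gcd_iff, hg, hm0, ne_eq, not_false_eq_true,
      and_true]
    exact and_comm
  rw [hset] at h
  rw [← sum_filter]
  unfold coprimeInd Nat.Coprime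
  exact_mod_cast h.symm

/-- Removing the coprimality condition from a harmonic sum. -/
lemma sum_coprimeInd {m N : ℕ} (hm : 1 ≤ m) {F : ℕ → ℝ} (hF : ∀ d, N < d → F d = 0) :
    ∑ e ∈ Icc 1 N, coprimeInd m e * F e / e =
      ∑ f ∈ m.divisors, (moebius f : ℝ) / f * ∑ g ∈ Icc 1 N, F (f * g) / g := by
  have h1 : ∀ e ∈ Icc 1 N, coprimeInd m e * F e / e =
      ∑ f ∈ m.divisors, if f ∣ e then (moebius f : ℝ) * F e / e else 0 := by
    intro e _
    rw [coprimeInd_eq_sum hm, mul_div_assoc, sum_mul]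
    exact sum_congr rfl fun f _ => by split_ifs <;> simp [mul_div_assoc]
  rw [sum_congr rfl h1, sum_comm]
  refine sum_congr rfl fun f hf => ?_
  rw [sum_ite_dvd (F := fun e => (moebius f : ℝ) * F e / e) (Nat.pos_of_mem_divisors hf)
    (fun d hd => by simp [hF d hd]), mul_sum]
  refine sum_congr rfl fun g _ => ?_
  push_cast
  rw [div_mul_div_comm]

lemma IsDyadicWeight.eq_zero_of_nat_lt {x : ℝ} {F : ℕ → ℝ} (hF : IsDyadicWeight x F)
    {N : ℕ} (hN : x ≤ N) (d : ℕ) (hd : N < d) : F d = 0 :=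
  hF.eq_zero_of_gt d (hN.trans_lt (by exact_mod_cast hd))

lemma div_natCast_le {x : ℝ} (hx : 0 < x) {k : ℕ} (hk : 1 ≤ k) : x / k ≤ x :=
  div_le_self hx.le (by exact_mod_cast hk)

lemma IsDyadicWeight.abs_sum_coprime_sub_le {x : ℝ} {F : ℕ → ℝ} (hF : IsDyadicWeight x F)
    (hx : 0 < x) {N : ℕ} (hN : x ≤ N) {m : ℕ} (hm : 1 ≤ m) :
    |∑ e ∈ Icc 1 N, coprimeInd m e * F e / e -
      Real.log 2 * ∑ f ∈ m.divisors, (moebius f : ℝ) / f| ≤ 10 * tau m / x := by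
  rw [sum_coprimeInd hm (hF.eq_zero_of_nat_lt hN), mul_sum, ← sum_sub_distrib]
  calc _ ≤ ∑ f ∈ m.divisors, |(moebius f : ℝ) / f * ∑ g ∈ Icc 1 N, F (f * g) / g -
        Real.log 2 * ((moebius f : ℝ) / f)| := abs_sum_le_sum_abs _ _
    _ ≤ ∑ f ∈ m.divisors, 10 / x := by
        refine sum_le_sum fun f hf => ?_
        have hf1 : 1 ≤ f := Nat.pos_of_mem_divisors hf
        have hf0 : (0 : ℝ) < f := by exact_mod_cast hf1
        have hb := (hF.comp_mul hf1).abs_sum_sub_log_two_le (by positivity)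
          ((div_natCast_le hx hf1).trans hN)
        have hmu : |(moebius f : ℝ)| ≤ 1 := by exact_mod_cast abs_moebius_le_one (n := f)
        rw [mul_comm (Real.log 2), ← mul_sub, abs_mul, abs_div, Nat.abs_cast]
        calc _ ≤ 1 / (f : ℝ) * (10 / (x / f)) := by gcongr
          _ = 10 / x := by field_simp
    _ = 10 * tau m / x := by
        rw [sum_const, nsmul_eq_mul, tau]
        ring

lemma IsDyadicWeight.sum_coprime_nonneg {x : ℝ} {F : ℕ → ℝ} (hF : IsDyadicWeight x F)
    (m N : ℕ) : 0 ≤ ∑ e ∈ Icc 1 N, coprimeInd m e * F e / e :=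
  sum_nonneg fun e _ =>
    div_nonneg (mul_nonneg (coprimeInd_nonneg m e) (hF.nonneg e)) (Nat.cast_nonneg e)

lemma IsDyadicWeight.sum_coprime_le {x : ℝ} {F : ℕ → ℝ} (hF : IsDyadicWeight x F)
    (hx : 0 < x) {N : ℕ} (hN : x ≤ N) (m : ℕ) :
    ∑ e ∈ Icc 1 N, coprimeInd m e * F e / e ≤ 11 := by
  refine le_trans (sum_le_sum fun e _ => ?_) (hF.sum_le hx hN)
  gcongr
  exact mul_le_of_le_one_left (hF.nonneg e) (coprimeInd_le_one m e)

lemma IsDyadicWeight.sum_totient_eq {x : ℝ} {F : ℕ → ℝ} (hF : IsDyadicWeight x F)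
    {N : ℕ} (hN : x ≤ N) (m : ℕ) :
    ∑ d ∈ Icc 1 N, coprimeInd m d * F d * (1 / ((Nat.totient d : ℕ) : ℝ)) =
      ∑ k ∈ Icc 1 N, totientWeight k *
        (coprimeInd m k * ∑ e ∈ Icc 1 N, coprimeInd m e * F (k * e) / e) := by
  rw [sum_div_totient (F := fun d => coprimeInd m d * F d)
    (fun d hd => by simp [hF.eq_zero_of_nat_lt hN d hd])]
  refine sum_congr rfl fun k _ => ?_
  congr 1
  rw [mul_sum]
  refine sum_congr rfl fun e _ => ?_
  rw [coprimeInd_mul]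
  ring

/-- The difference of two dyadic sums of `1/φ` over integers coprime to `m` is bounded by a
sum over `k` in which each term involves only harmonic sums. -/
lemma abs_dyadic_totient_sub_le {l z : ℝ} {F G : ℕ → ℝ} (hF : IsDyadicWeight l F)
    (hG : IsDyadicWeight z G) {N : ℕ} (hlz : l ≤ z) (hN : z ≤ N) (m : ℕ) :
    |∑ d ∈ Icc 1 N, coprimeInd m d * F d * (1 / ((Nat.totient d : ℕ) : ℝ)) -
      ∑ d ∈ Icc 1 N, coprimeInd m d * G d * (1 / ((Nat.totient d : ℕ) : ℝ))| ≤
    ∑ k ∈ Icc 1 N, totientWeight k * |∑ e ∈ Icc 1 N, coprimeInd m e * F (k * e) / e -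
      ∑ e ∈ Icc 1 N, coprimeInd m e * G (k * e) / e| := by
  rw [hF.sum_totient_eq (hlz.trans hN), hG.sum_totient_eq hN, ← sum_sub_distrib]
  refine (abs_sum_le_sum_abs _ _).trans (sum_le_sum fun k _ => ?_)
  rw [← mul_sub, ← mul_sub, abs_mul, abs_mul, abs_of_nonneg (totientWeight_nonneg k),
    abs_of_nonneg (coprimeInd_nonneg m k)]
  exact mul_le_mul_of_nonneg_left
    (mul_le_of_le_one_left (abs_nonneg _) (coprimeInd_le_one m k)) (totientWeight_nonneg k)

lemma abs_dyadic_harmonic_sub_le {l z : ℝ} {F G : ℕ → ℝ} (hF : IsDyadicWeight l F)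
    (hG : IsDyadicWeight z G) {N : ℕ} (hl : 0 < l) (hlz : l ≤ z) (hN : z ≤ N) (m : ℕ) :
    |∑ e ∈ Icc 1 N, coprimeInd m e * F e / e - ∑ e ∈ Icc 1 N, coprimeInd m e * G e / e| ≤
      11 := by
  have h1 := hF.sum_coprime_nonneg m N
  have h2 := hG.sum_coprime_nonneg m N
  have h3 := hF.sum_coprime_le hl (hlz.trans hN) m
  have h4 := hG.sum_coprime_le (hl.trans_le hlz) hN m
  rw [abs_le]
  constructor <;> linarith

lemma abs_dyadic_harmonic_sub_le_tau {l z : ℝ} {F G : ℕ → ℝ} (hF : IsDyadicWeight l F)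
    (hG : IsDyadicWeight z G) {N : ℕ} (hl : 0 < l) (hlz : l ≤ z) (hN : z ≤ N) {m : ℕ}
    (hm : 1 ≤ m) :
    |∑ e ∈ Icc 1 N, coprimeInd m e * F e / e - ∑ e ∈ Icc 1 N, coprimeInd m e * G e / e| ≤
      20 * tau m / l := by
  have h1 := hF.abs_sum_coprime_sub_le hl (hlz.trans hN) hm
  have h2 := hG.abs_sum_coprime_sub_le (hl.trans_le hlz) hN hm
  have h3 : 10 * (tau m : ℝ) / z ≤ 10 * tau m / l := by gcongr
  have h4 : 20 * (tau m : ℝ) / l = 10 * tau m / l + 10 * tau m / l := by ring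
  rw [h4]
  rw [abs_le] at h1 h2 ⊢
  constructor <;> linarith

lemma abs_dyadic_totient_sub_le_const {l z : ℝ} {F G : ℕ → ℝ} (hF : IsDyadicWeight l F)
    (hG : IsDyadicWeight z G) {N : ℕ} (hl : 0 < l) (hlz : l ≤ z) (hN : z ≤ N) (m : ℕ) :
    |∑ d ∈ Icc 1 N, coprimeInd m d * F d * (1 / ((Nat.totient d : ℕ) : ℝ)) -
      ∑ d ∈ Icc 1 N, coprimeInd m d * G d * (1 / ((Nat.totient d : ℕ) : ℝ))| ≤ 33 := by
  refine (abs_dyadic_totient_sub_le hF hG hlz hN m).trans ?_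
  calc _ ≤ ∑ k ∈ Icc 1 N, totientWeight k * 11 := by
        refine sum_le_sum fun k hk => mul_le_mul_of_nonneg_left ?_ (totientWeight_nonneg k)
        have hk1 := (mem_Icc.1 hk).1
        have hk0 : (0 : ℝ) < k := by exact_mod_cast hk1
        exact abs_dyadic_harmonic_sub_le (hF.comp_mul hk1) (hG.comp_mul hk1) (by positivity)
          (by gcongr) ((div_natCast_le (hl.trans_le hlz) hk1).trans hN) m
    _ = (∑ k ∈ Icc 1 N, totientWeight k) * 11 := by rw [sum_mul]
    _ ≤ 33 := by linarith [sum_totientWeight_le N]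

lemma abs_dyadic_totient_sub_le_tau {l z : ℝ} {F G : ℕ → ℝ} (hF : IsDyadicWeight l F)
    (hG : IsDyadicWeight z G) {N : ℕ} (hl : 1 ≤ l) (hlz : l ≤ z) (hN : z ≤ N) {m : ℕ}
    (hm : 1 ≤ m) :
    |∑ d ∈ Icc 1 N, coprimeInd m d * F d * (1 / ((Nat.totient d : ℕ) : ℝ)) -
      ∑ d ∈ Icc 1 N, coprimeInd m d * G d * (1 / ((Nat.totient d : ℕ) : ℝ))| ≤
      20 * tau m / l * (3 * (1 + Real.log l)) + 66 / l := by
  have hl0 : 0 < l := by linarith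
  refine (abs_dyadic_totient_sub_le hF hG hlz hN m).trans ?_
  calc _ ≤ ∑ k ∈ Icc 1 N, ((if (k : ℝ) ≤ l then 20 * tau m / l * (1 / ((Nat.totient k : ℕ) : ℝ))
        else 0) + (if l < k then totientWeight k else 0) * 11) := by
        refine sum_le_sum fun k hk => ?_
        have hk1 := (mem_Icc.1 hk).1
        have hk0 : (0 : ℝ) < k := by exact_mod_cast hk1
        have hzk := (div_natCast_le (hl0.trans_le hlz) hk1).trans hN
        rcases le_or_gt (k : ℝ) l with h | h
        · rw [if_pos h, if_neg h.not_gt, zero_mul, add_zero]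
          have hb := abs_dyadic_harmonic_sub_le_tau (hF.comp_mul hk1) (hG.comp_mul hk1)
            (by positivity) (by gcongr) hzk hm
          calc _ ≤ ((k : ℝ) * (Nat.totient k : ℕ))⁻¹ * (20 * tau m / (l / k)) :=
                mul_le_mul (totientWeight_le k) hb (abs_nonneg _) (by positivity)
            _ = _ := by
                have : (0 : ℝ) < (Nat.totient k : ℕ) := by exact_mod_cast Nat.totient_pos.2 hk1
                field_simp
        · rw [if_neg h.not_ge, if_pos h, zero_add]
          exact mul_le_mul_of_nonneg_left
            (abs_dyadic_harmonic_sub_le (hF.comp_mul hk1) (hG.comp_mul hk1) (by positivity)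
              (by gcongr) hzk m) (totientWeight_nonneg k)
    _ = 20 * tau m / l * (∑ k ∈ Icc 1 N with ((k : ℕ) : ℝ) ≤ l, 1 / ((Nat.totient k : ℕ) : ℝ)) +
        (∑ k ∈ Icc 1 N, if l < k then totientWeight k else 0) * 11 := by
        rw [sum_add_distrib, sum_mul, mul_sum, sum_filter]
    _ ≤ 20 * tau m / l * (3 * (1 + Real.log l)) + 6 / l * 11 := by
        gcongr
        · refine le_trans (sum_le_sum_of_subset_of_nonneg (fun k hk => ?_)
            fun k _ _ => by positivity) (sum_inv_totient_le hl)
          simp only [mem_filter, mem_Icc] at hk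
          exact mem_Icc.2 ⟨hk.1.1, Nat.le_floor hk.2⟩
        · exact sum_totientWeight_tail_le hl0 N
    _ = _ := by ring

lemma isDyadicWeight_ite {x : ℝ} {P : ℕ → Prop} [DecidablePred P]
    (h1 : ∀ d : ℕ, x / 2 < d → d < x → P d)
    (h2 : ∀ d : ℕ, P d → x / 2 ≤ d ∧ (d : ℝ) ≤ x) :
    IsDyadicWeight x (fun d => if P d then 1 else 0) where
  nonneg d := by split_ifs <;> norm_num
  le_one d := by split_ifs <;> norm_num
  eq_one d h h' := if_pos (h1 d h h')
  eq_zero_of_lt _ h := if_neg fun hP => h.not_ge (h2 _ hP).1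
  eq_zero_of_gt _ h := if_neg fun hP => h.not_ge (h2 _ hP).2

lemma sum_filter_dyadic_eq {x : ℝ} {P : ℕ → Prop} [DecidablePred P]
    (hP : ∀ d : ℕ, P d → (d : ℝ) ≤ x)
    {N m : ℕ} (hN : ⌈x⌉₊ ≤ N) {s : Finset ℕ}
    (hs : ∀ d, d ∈ s ↔ d ∈ Icc 1 ⌈x⌉₊ ∧ P d ∧ Nat.Coprime d m) :
    ∑ d ∈ s, 1 / (Nat.totient d : ℝ) =
      ∑ d ∈ Icc 1 N, coprimeInd m d * (if P d then 1 else 0) * (1 / ((Nat.totient d : ℕ) : ℝ)) := by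
  have hset : s = {d ∈ Icc 1 N | P d ∧ Nat.Coprime d m} := by
    ext d
    simp only [hs, mem_filter, mem_Icc]
    refine ⟨fun h => ⟨⟨h.1.1, h.1.2.trans hN⟩, h.2⟩, fun h => ⟨⟨h.1.1, ?_⟩, h.2⟩⟩
    exact_mod_cast (hP d h.2.1).trans (Nat.le_ceil x)
  rw [hset, sum_filter]
  refine sum_congr rfl fun d _ => ?_
  by_cases h1 : P d <;> by_cases h2 : Nat.Coprime d m <;> simp [h1, h2, coprimeInd]

lemma Cmlz_eq {m : ℕ} {l z : ℝ} (hlz : l ≤ z) :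
    Cmlz m l z =
      ∑ d ∈ Icc 1 ⌈z⌉₊, coprimeInd m d * (if l / 2 ≤ (d : ℝ) ∧ (d : ℝ) < l then 1 else 0) *
        (1 / ((Nat.totient d : ℕ) : ℝ)) -
      ∑ d ∈ Icc 1 ⌈z⌉₊, coprimeInd m d * (if z / 2 < (d : ℝ) ∧ (d : ℝ) ≤ z then 1 else 0) *
        (1 / ((Nat.totient d : ℕ) : ℝ)) := by
  unfold Cmlz
  congr 1
  · exact sum_filter_dyadic_eq (P := fun d => l / 2 ≤ (d : ℝ) ∧ (d : ℝ) < l)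
      (fun d h => h.2.le) (Nat.ceil_mono hlz) fun d => by simp only [mem_filter, and_assoc]
  · exact sum_filter_dyadic_eq (P := fun d => z / 2 < (d : ℝ) ∧ (d : ℝ) ≤ z)
      (fun d h => h.2) le_rfl fun d => by simp only [mem_filter, and_assoc]

/-- Lemma 1 of the paper: for `m ∈ ℕ` and `z ≥ l > 0`,
`|C_{m,l,z}| ≪ min{1, τ(m) log(l+2)/(l+2)}` with an absolute implied constant. -/
theorem statement_3 :
    ∃ C : ℝ, 0 < C ∧ ∀ (m : ℕ) (l z : ℝ), 1 ≤ m → 0 < l → l ≤ z →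
      |Cmlz m l z| ≤ C * min 1 ((tau m : ℝ) * Real.log (l + 2) / (l + 2)) := by
  refine ⟨1000, by norm_num, fun m l z hm hl hlz => ?_⟩
  have hF : IsDyadicWeight l (fun d => if l / 2 ≤ (d : ℝ) ∧ (d : ℝ) < l then 1 else 0) :=
    isDyadicWeight_ite (P := fun d : ℕ => l / 2 ≤ (d : ℝ) ∧ (d : ℝ) < l)
      (fun d h h' => ⟨h.le, h'⟩) (fun d h => ⟨h.1, h.2.le⟩)
  have hG : IsDyadicWeight z (fun d => if z / 2 < (d : ℝ) ∧ (d : ℝ) ≤ z then 1 else 0) :=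
    isDyadicWeight_ite (P := fun d : ℕ => z / 2 < (d : ℝ) ∧ (d : ℝ) ≤ z)
      (fun d h h' => ⟨h, h'.le⟩) (fun d h => ⟨h.1.le, h.2⟩)
  have hconst := abs_dyadic_totient_sub_le_const hF hG hl hlz (Nat.le_ceil z) m
  have htau : (1 : ℝ) ≤ tau m := by
    have : 0 < tau m := card_pos.2 ⟨1, Nat.one_mem_divisors.2 (by omega)⟩
    exact_mod_cast this
  rw [← Cmlz_eq hlz] at hconst
  rw [mul_min_of_nonneg _ _ (by norm_num : (0 : ℝ) ≤ 1000)]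
  refine le_min (by linarith) ?_
  rcases lt_or_ge l 1 with h | h
  · refine hconst.trans ?_
    have h1 : (0.5 : ℝ) ≤ Real.log (l + 2) := by
      have := Real.log_two_gt_d9
      have := Real.log_le_log (by norm_num : (0 : ℝ) < 2) (by linarith : 2 ≤ l + 2)
      linarith
    have h2 : (0.5 : ℝ) ≤ tau m * Real.log (l + 2) := by nlinarith
    rw [← mul_div_assoc, le_div_iff₀ (by linarith)]
    linarith
  · have hmain := abs_dyadic_totient_sub_le_tau hF hG h hlz (Nat.le_ceil z) hm
    rw [← Cmlz_eq hlz] at hmain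
    refine hmain.trans ?_
    set L := Real.log (l + 2) with hL
    have h1 : 1 ≤ L := by
      rw [hL, Real.le_log_iff_exp_le (by linarith)]
      linarith [Real.exp_one_lt_three]
    have h2 : Real.log l ≤ L := Real.log_le_log hl (by linarith)
    have h3 : 1 ≤ tau m * L := by nlinarith
    calc 20 * tau m / l * (3 * (1 + Real.log l)) + 66 / l
        ≤ 20 * tau m / l * (3 * (L + L)) + 66 * (tau m * L) / l := by
          gcongr
          linarith
      _ = 186 * (tau m * L) / l := by ring
      _ ≤ 1000 * (tau m * L / (l + 2)) := by
          rw [← mul_div_assoc, div_le_div_iff₀ hl (by linarith)]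
          nlinarith
end

section
/- Let √(2x) < Q ≤ x be large and let (a_n)_{n ≤ x} be a real sequence satisfying the Hereditarily Sparse condition: for some K_hered > 0, for every natural number h ≤ 2x/Q and every interval I of length Q/2, Σ_{n ∈ I} |a_{nh}| τ(n) ≤ (1/K_hered) · (Σ_{n ≤ x} |a_n|)² / (Σ_{n ≤ x} |a_n| τ₃(n)). Then | Σ_{h ≤ 2x/Q} Σ_{0 ≤ l ≤ 2x/(Qh)} Σ_{(n₁,n₂) ∈ 𝒮_{h,l}} a_{n₁h} a_{n₂h} C_{n₁n₂, l+1, Q/h} | ≪ log²(2 + x/Q) · (Σ_{n ≤ x} |a_n|)² / K_hered, with an absolute implied constant. -/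
open scoped Classical

/-- `τ₃(n) := #{(u,v,w) ∈ ℕ³ : uvw = n}`, the threefold divisor function. -/
noncomputable def tau3 (n : ℕ) : ℕ := Nat.card {t : ℕ × ℕ × ℕ // t.1 * t.2.1 * t.2.2 = n}

/-- `𝒮_{h,l} := {(n₁,n₂) : 1 ≤ n₂ < n₁ ≤ x/h, lQ/2 < n₁ − n₂ ≤ (l+1)Q/2}`. -/
noncomputable def Shl (x Q : ℝ) (h l : ℕ) : Finset (ℕ × ℕ) :=
  (Finset.Icc 1 ⌊x / h⌋₊ ×ˢ Finset.Icc 1 ⌊x / h⌋₊).filter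
    (fun p : ℕ × ℕ => p.2 < p.1 ∧ (l : ℝ) * Q / 2 < (p.1 : ℝ) - (p.2 : ℝ) ∧
      (p.1 : ℝ) - (p.2 : ℝ) ≤ ((l : ℝ) + 1) * Q / 2)

theorem tau_mul_le (m n : ℕ) : tau (m * n) ≤ tau m * tau n := by
  unfold tau
  rw [Nat.divisors_mul]
  exact Finset.card_mul_le

theorem tau_le_two_mul_sqrt (n : ℕ) : tau n ≤ 2 * n.sqrt := by
  have hsub : n.divisors ⊆
      Finset.Icc 1 n.sqrt ∪ (Finset.Icc 1 n.sqrt).image (fun d => n / d) := by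
    intro d hd
    obtain ⟨⟨k, rfl⟩, hn⟩ := Nat.mem_divisors.mp hd
    have hd0 : 0 < d := Nat.pos_of_ne_zero (left_ne_zero_of_mul hn)
    have hk0 : 0 < k := Nat.pos_of_ne_zero (right_ne_zero_of_mul hn)
    rw [Finset.mem_union, Finset.mem_image]
    by_cases h : d ≤ (d * k).sqrt
    · exact Or.inl (Finset.mem_Icc.mpr ⟨hd0, h⟩)
    · refine Or.inr ⟨k, Finset.mem_Icc.mpr ⟨hk0, ?_⟩, Nat.mul_div_cancel _ hk0⟩
      by_contra hk
      have h1 := Nat.sqrt_lt'.mp (lt_of_not_ge h)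
      have h2 := Nat.sqrt_lt'.mp (lt_of_not_ge hk)
      nlinarith
  calc tau n ≤ _ := Finset.card_le_card hsub
    _ ≤ _ := Finset.card_union_le _ _
    _ ≤ n.sqrt + n.sqrt := by
        refine add_le_add (by simp) (Finset.card_image_le.trans (by simp))
    _ = _ := by ring

theorem le_tau_mul_totient (n : ℕ) : n ≤ tau n * n.totient := by
  rcases Nat.eq_zero_or_pos n with rfl | hn
  · simp
  calc n = ∑ d ∈ n.divisors, d.totient := (Nat.sum_totient n).symm
    _ ≤ ∑ _d ∈ n.divisors, n.totient := Finset.sum_le_sum fun d hd =>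
        Nat.le_of_dvd (Nat.totient_pos.mpr hn)
          (Nat.totient_dvd_of_dvd (Nat.dvd_of_mem_divisors hd))
    _ = _ := by simp [tau]

theorem sqrt_le_two_mul_totient (n : ℕ) : Real.sqrt n ≤ 2 * (n.totient : ℝ) := by
  rcases Nat.eq_zero_or_pos n with rfl | hn
  · simp
  have h1 : (n : ℝ) ≤ 2 * Real.sqrt n * n.totient := by
    have h := le_tau_mul_totient n
    have h' : n ≤ 2 * n.sqrt * n.totient := h.trans (by gcongr; exact tau_le_two_mul_sqrt n)
    calc (n : ℝ) ≤ 2 * (n.sqrt : ℝ) * n.totient := by exact_mod_cast h'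
      _ ≤ _ := by gcongr; exact Real.nat_sqrt_le_real_sqrt
  have hs : 0 < Real.sqrt n := Real.sqrt_pos.mpr (by exact_mod_cast hn)
  have h2 := Real.mul_self_sqrt (Nat.cast_nonneg (α := ℝ) n)
  nlinarith

/-- The summand in `n / φ(n) = ∑ d ∣ n, μ²(d) / φ(d)`. -/
noncomputable def invTotientSqfree (b : ℕ) : ℝ := if Squarefree b then (b.totient : ℝ)⁻¹ else 0

theorem invTotientSqfree_nonneg (b : ℕ) : 0 ≤ invTotientSqfree b := by
  unfold invTotientSqfree; split_ifs <;> positivity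

theorem invTotientSqfree_le (b : ℕ) : invTotientSqfree b ≤ (b.totient : ℝ)⁻¹ := by
  unfold invTotientSqfree; split_ifs
  · exact le_rfl
  · positivity

theorem sum_divisors_invTotientSqfree {d : ℕ} (hd : d ≠ 0) :
    ∑ b ∈ d.divisors, invTotientSqfree b = d / (d.totient : ℝ) := by
  have hprime : ∀ p ∈ d.primeFactors, 1 < (p : ℝ) := fun p hp => by
    exact_mod_cast (Nat.prime_of_mem_primeFactors hp).one_lt
  have h1 : ∑ b ∈ d.divisors, invTotientSqfree b =
      ∑ t ∈ d.primeFactors.powerset, ∏ p ∈ t, ((p : ℝ) - 1)⁻¹ := by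
    unfold invTotientSqfree
    rw [← Finset.sum_filter, Nat.sum_divisors_filter_squarefree hd]
    have hfac : (UniqueFactorizationMonoid.normalizedFactors d).toFinset = d.primeFactors := by
      rw [Nat.factors_eq]; rfl
    rw [hfac]
    refine Finset.sum_congr rfl fun t ht => ?_
    have hval : t.val.prod = ∏ p ∈ t, p := Finset.prod_val t
    have htp : ∀ p ∈ t, p.Prime := fun p hp =>
      Nat.prime_of_mem_primeFactors (Finset.mem_powerset.mp ht hp)
    rw [hval, Finset.prod_inv_distrib]
    have htot := Nat.totient_mul_prod_primeFactors (∏ p ∈ t, p)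
    rw [Nat.primeFactors_prod htp, mul_comm] at htot
    rw [Nat.eq_of_mul_eq_mul_left (Finset.prod_pos fun p hp => (htp p hp).pos) htot,
      Nat.cast_prod]
    congr 1
    exact Finset.prod_congr rfl fun p hp => Nat.cast_pred (htp p hp).pos
  rw [h1, ← Finset.prod_one_add]
  have h2 : (d.totient : ℝ) = d * ∏ p ∈ d.primeFactors, (1 - (p : ℝ)⁻¹) := by
    have := Nat.totient_eq_mul_prod_factors d
    have h := congrArg (fun q : ℚ => (q : ℝ)) this
    push_cast at h
    exact h
  have h3 : (∏ p ∈ d.primeFactors, (1 + ((p : ℝ) - 1)⁻¹)) *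
      ∏ p ∈ d.primeFactors, (1 - (p : ℝ)⁻¹) = 1 := by
    rw [← Finset.prod_mul_distrib]
    refine Finset.prod_eq_one fun p hp => ?_
    have := hprime p hp
    have h' : (p : ℝ) - 1 ≠ 0 := by linarith
    field_simp
    ring
  have h4 : (d.totient : ℝ) ≠ 0 := by
    exact_mod_cast (Nat.totient_pos.mpr (Nat.pos_of_ne_zero hd)).ne'
  rw [eq_div_iff h4, h2]
  linear_combination (d : ℝ) * h3

theorem sum_moebius_dvd {q m : ℕ} (hm : m ≠ 0) (hq : q ≠ 0) :
    ∑ e ∈ q.divisors, (if e ∣ m then (ArithmeticFunction.moebius e : ℝ) else 0) =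
      if q.Coprime m then 1 else 0 := by
  have hg : q.gcd m ≠ 0 := Nat.gcd_ne_zero_left hq
  have h : q.divisors.filter (· ∣ m) = (q.gcd m).divisors := by
    ext e
    simp [Nat.dvd_gcd_iff, hq, hm]
  rw [← Finset.sum_filter, h]
  have h2 := congrArg (fun f => f (q.gcd m)) ArithmeticFunction.moebius_mul_coe_zeta
  simp only [ArithmeticFunction.coe_mul_zeta_apply, ArithmeticFunction.one_apply] at h2
  unfold Nat.Coprime
  exact_mod_cast congrArg (fun z : ℤ => (z : ℝ)) h2

theorem sum_mul_sum_divisorsAntidiagonal (N : ℕ) (G f g : ℕ → ℝ) (hG : ∀ d, N < d → G d = 0) :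
    ∑ d ∈ Finset.Icc 1 N, G d * ∑ p ∈ d.divisorsAntidiagonal, f p.1 * g p.2 =
      ∑ b ∈ Finset.Icc 1 N, ∑ k ∈ Finset.Icc 1 N, G (b * k) * (f b * g k) := by
  simp_rw [Finset.mul_sum]
  rw [Finset.sum_sigma', ← Finset.sum_product']
  have hres : ∑ p ∈ Finset.Icc 1 N ×ˢ Finset.Icc 1 N, G (p.1 * p.2) * (f p.1 * g p.2) =
      ∑ p ∈ (Finset.Icc 1 N ×ˢ Finset.Icc 1 N).filter (fun p => p.1 * p.2 ≤ N),
        G (p.1 * p.2) * (f p.1 * g p.2) := by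
    symm
    refine Finset.sum_subset (Finset.filter_subset _ _) fun p hp hp' => ?_
    rw [hG, zero_mul]
    by_contra h
    exact hp' (Finset.mem_filter.mpr ⟨hp, not_lt.mp h⟩)
  rw [hres]
  refine Finset.sum_bij' (fun s _ => s.2) (fun p _ => ⟨p.1 * p.2, p⟩) ?_ ?_ ?_ ?_ ?_
  · rintro ⟨d, b, k⟩ h
    simp only [Finset.mem_sigma, Finset.mem_Icc, Nat.mem_divisorsAntidiagonal] at h
    obtain ⟨⟨h1, h2⟩, rfl, h3⟩ := h
    have hb := Nat.pos_of_ne_zero (left_ne_zero_of_mul h3)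
    have hk := Nat.pos_of_ne_zero (right_ne_zero_of_mul h3)
    simp only [Finset.mem_filter, Finset.mem_product, Finset.mem_Icc]
    refine ⟨⟨⟨hb, ?_⟩, hk, ?_⟩, h2⟩ <;> nlinarith
  · rintro ⟨b, k⟩ h
    simp only [Finset.mem_filter, Finset.mem_product, Finset.mem_Icc] at h
    simp only [Finset.mem_sigma, Finset.mem_Icc, Nat.mem_divisorsAntidiagonal]
    have := Nat.mul_pos h.1.1.1 h.1.2.1
    exact ⟨⟨this, h.2⟩, trivial, this.ne'⟩
  · rintro ⟨d, b, k⟩ h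
    simp only [Finset.mem_sigma, Nat.mem_divisorsAntidiagonal] at h
    obtain ⟨-, rfl, -⟩ := h
    rfl
  · intro p _; rfl
  · rintro ⟨d, b, k⟩ h
    simp only [Finset.mem_sigma, Nat.mem_divisorsAntidiagonal] at h
    obtain ⟨-, rfl, -⟩ := h
    rfl

theorem sum_tau_le_tau3 {n : ℕ} (hn : n ≠ 0) :
    ∑ p ∈ n.divisorsAntidiagonal, tau p.2 ≤ tau3 n := by
  have hcard : tau3 n = ((n.divisors ×ˢ n.divisors ×ˢ n.divisors).filter
      (fun t : ℕ × ℕ × ℕ => t.1 * t.2.1 * t.2.2 = n)).card := by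
    unfold tau3
    refine Nat.subtype_card _ fun t => ?_
    simp only [Finset.mem_filter, Finset.mem_product, Nat.mem_divisors]
    refine ⟨fun h => h.2, fun h => ⟨⟨⟨?_, hn⟩, ⟨?_, hn⟩, ?_, hn⟩, h⟩⟩
    · exact ⟨t.2.1 * t.2.2, by rw [← h]; ring⟩
    · exact ⟨t.1 * t.2.2, by rw [← h]; ring⟩
    · exact ⟨t.1 * t.2.1, by rw [← h]; ring⟩
  unfold tau
  rw [hcard, ← Finset.card_sigma]
  refine Finset.card_le_card_of_injOn (fun s => (s.1.1, s.2, s.1.2 / s.2)) ?_ ?_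
  · rintro ⟨⟨b, k⟩, u⟩ h
    simp only [Finset.coe_sigma, Set.mem_sigma_iff, Finset.mem_coe,
      Nat.mem_divisorsAntidiagonal, Nat.mem_divisors] at h
    obtain ⟨⟨rfl, h1⟩, ⟨v, rfl⟩, h3⟩ := h
    have hu := Nat.pos_of_ne_zero (left_ne_zero_of_mul h3)
    simp only [Finset.coe_filter, Finset.mem_product, Nat.mem_divisors, Set.mem_ofPred_eq,
      Nat.mul_div_cancel_left v hu]
    refine ⟨⟨⟨⟨u * v, rfl⟩, h1⟩, ⟨⟨b * v, by ring⟩, h1⟩, ⟨b * u, by ring⟩, h1⟩, by ring⟩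
  · rintro ⟨⟨b, k⟩, u⟩ h ⟨⟨b', k'⟩, u'⟩ h' heq
    simp only [Finset.coe_sigma, Set.mem_sigma_iff, Finset.mem_coe,
      Nat.mem_divisorsAntidiagonal] at h h'
    simp only [Prod.mk.injEq] at heq
    obtain ⟨rfl, rfl, -⟩ := heq
    have hk : k = k' := Nat.eq_of_mul_eq_mul_left
      (Nat.pos_of_ne_zero fun hb => h.1.2 (by rw [← h.1.1, hb, zero_mul])) (h.1.1.trans h'.1.1.symm)
    subst hk
    rfl

theorem abs_harmonic_floor_sub_log_le {u : ℝ} (hu : 1 ≤ u) :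
    |(harmonic ⌊u⌋₊ : ℝ) - Real.log u - Real.eulerMascheroniConstant| ≤ 2 / u := by
  set n := ⌊u⌋₊ with hn
  have hn1 : 1 ≤ n := Nat.le_floor (by simpa using hu)
  have hn1' : (1 : ℝ) ≤ n := by exact_mod_cast hn1
  have hnu : (n : ℝ) ≤ u := Nat.floor_le (by linarith)
  have hun : u < n + 1 := Nat.lt_floor_add_one u
  have h1 := Real.eulerMascheroniSeq_lt_eulerMascheroniConstant n
  have h2 := Real.eulerMascheroniConstant_lt_eulerMascheroniSeq' n
  rw [Real.eulerMascheroniSeq] at h1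
  rw [Real.eulerMascheroniSeq', if_neg (by omega)] at h2
  have h3 : Real.log n ≤ Real.log u := Real.log_le_log (by linarith) hnu
  have h4 : Real.log u ≤ Real.log (n + 1) := Real.log_le_log (by linarith) hun.le
  have h5 : Real.log (n + 1) - Real.log n ≤ 1 / n := by
    rw [← Real.log_div (by linarith) (by linarith)]
    refine (Real.log_le_sub_one_of_pos (by positivity)).trans (le_of_eq ?_)
    field_simp
    ring
  have h6 : (1 : ℝ) / n ≤ 2 / u := by
    rw [div_le_div_iff₀ (by linarith) (by linarith)]; linarith
  rw [abs_le]; constructor <;> linarith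

theorem sum_Ioc_inv_eq_harmonic_sub {m n : ℕ} (h : m ≤ n) :
    ∑ k ∈ Finset.Ioc m n, (k : ℝ)⁻¹ = (harmonic n : ℝ) - harmonic m := by
  have hsum : ∀ n : ℕ, (harmonic n : ℝ) = ∑ k ∈ Finset.Ioc 0 n, (k : ℝ)⁻¹ := fun n => by
    rw [harmonic_eq_sum_Icc]
    push_cast
    rfl
  rw [hsum, hsum, ← Finset.sum_Ioc_consecutive _ (Nat.zero_le m) h]
  ring

theorem abs_sum_Ioc_half_sub_log_two_le {u : ℝ} (hu : 0 < u) :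
    |∑ k ∈ Finset.Ioc ⌊u / 2⌋₊ ⌊u⌋₊, (k : ℝ)⁻¹ - Real.log 2| ≤ 6 / u := by
  have hl2 := Real.log_two_lt_d9
  have hl2' := Real.log_two_gt_d9
  rcases lt_or_ge u 1 with h1 | h1
  · rw [Nat.floor_eq_zero.mpr h1, Nat.floor_eq_zero.mpr (by linarith), Finset.Ioc_self,
      Finset.sum_empty, zero_sub, abs_neg, abs_of_pos (by linarith), le_div_iff₀ hu]
    nlinarith
  rw [sum_Ioc_inv_eq_harmonic_sub (Nat.floor_mono (by linarith))]
  rcases lt_or_ge u 2 with h2 | h2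
  · have hf1 : ⌊u⌋₊ = 1 := (Nat.floor_eq_iff (by linarith)).mpr
      ⟨by simpa using h1, by push_cast; linarith⟩
    have hf0 : ⌊u / 2⌋₊ = 0 := Nat.floor_eq_zero.mpr (by linarith)
    rw [hf1, hf0]
    have : (3 : ℝ) ≤ 6 / u := by rw [le_div_iff₀ hu]; linarith
    simp only [harmonic_zero, harmonic_succ, zero_add]
    push_cast
    rw [abs_le]
    constructor <;> linarith
  · have ha := abs_le.mp (abs_harmonic_floor_sub_log_le h1)
    have hb := abs_le.mp (abs_harmonic_floor_sub_log_le (u := u / 2) (by linarith))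
    rw [Real.log_div (by linarith) (by norm_num)] at hb
    have hc : 2 / (u / 2) = 4 / u := by field_simp; norm_num
    have hd : 6 / u = 2 / u + 4 / u := by ring
    rw [hc] at hb
    rw [abs_le, hd]
    constructor <;> linarith

theorem filter_dyadic_eq_Ioc {w z : ℝ} (hw : 0 < w) (hz : 0 ≤ z) {N : ℕ} (hN : z / w ≤ N) :
    (Finset.Icc 1 N).filter (fun k : ℕ => z / 2 < w * k ∧ w * k ≤ z) =
      Finset.Ioc ⌊z / w / 2⌋₊ ⌊z / w⌋₊ := by
  ext k
  have hzw : 0 ≤ z / w := by positivity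
  have e1 : z / w / 2 < k ↔ z / 2 < w * k := by
    rw [div_div, mul_comm w 2, ← div_div, div_lt_iff₀ hw, mul_comm]
  have e2 : (k : ℝ) ≤ z / w ↔ w * k ≤ z := by rw [le_div_iff₀ hw, mul_comm]
  rw [Finset.mem_filter, Finset.mem_Icc, Finset.mem_Ioc, Nat.floor_lt (by positivity),
    Nat.le_floor_iff hzw, e1, e2]
  refine ⟨fun h => h.2, fun h => ⟨⟨?_, ?_⟩, h⟩⟩
  · have hk : (0 : ℝ) < k := lt_of_le_of_lt (by positivity) (e1.mpr h.1)
    exact_mod_cast hk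
  · exact_mod_cast (e2.mpr h.2).trans hN

theorem abs_sum_dyadic_sub_log_two_le {w z : ℝ} (hw : 0 < w) (hz : 0 < z) {N : ℕ}
    (hN : z / w ≤ N) :
    |∑ k ∈ Finset.Icc 1 N, (if z / 2 < w * k ∧ w * k ≤ z then (k : ℝ)⁻¹ else 0) - Real.log 2|
      ≤ 6 * (w / z) := by
  rw [← Finset.sum_filter, filter_dyadic_eq_Ioc hw hz.le hN]
  refine (abs_sum_Ioc_half_sub_log_two_le (div_pos hz hw)).trans (le_of_eq ?_)
  field_simp

theorem sum_ite_mul_eq_le {w c : ℝ} (hw : 0 < w) (hc : 0 < c) (N : ℕ) :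
    ∑ k ∈ Finset.Icc 1 N, (if w * k = c then (k : ℝ)⁻¹ else 0) ≤ w / c := by
  by_cases h : ∃ j ∈ Finset.Icc 1 N, w * (j : ℝ) = c
  · obtain ⟨j, hj, hjc⟩ := h
    rw [Finset.sum_eq_single_of_mem j hj, if_pos hjc, ← hjc]
    · have : (0 : ℝ) < j := by exact_mod_cast (Finset.mem_Icc.mp hj).1
      rw [le_div_iff₀ (by positivity)]
      field_simp
      exact le_rfl
    · intro k _ hk
      refine if_neg fun hkc => hk ?_
      exact_mod_cast mul_left_cancel₀ hw.ne' (hkc.trans hjc.symm)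
  · push Not at h
    rw [Finset.sum_eq_zero fun k hk => if_neg (h k hk)]
    positivity

theorem abs_sum_dyadic_left_closed_sub_log_two_le {w z : ℝ} (hw : 0 < w) (hz : 0 < z) {N : ℕ}
    (hN : z / w ≤ N) :
    |∑ k ∈ Finset.Icc 1 N, (if z / 2 ≤ w * k ∧ w * k < z then (k : ℝ)⁻¹ else 0) - Real.log 2|
      ≤ 8 * (w / z) := by
  have hsplit : ∑ k ∈ Finset.Icc 1 N, (if z / 2 ≤ w * k ∧ w * k < z then (k : ℝ)⁻¹ else 0) =
      ∑ k ∈ Finset.Icc 1 N, (if z / 2 < w * k ∧ w * k ≤ z then (k : ℝ)⁻¹ else 0)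
      + ∑ k ∈ Finset.Icc 1 N, (if w * k = z / 2 then (k : ℝ)⁻¹ else 0)
      - ∑ k ∈ Finset.Icc 1 N, (if w * k = z then (k : ℝ)⁻¹ else 0) := by
    rw [← Finset.sum_add_distrib, ← Finset.sum_sub_distrib]
    refine Finset.sum_congr rfl fun k _ => ?_
    rcases lt_trichotomy (w * (k : ℝ)) (z / 2) with h | h | h
    · rw [if_neg (by intro h'; linarith [h'.1]), if_neg (by intro h'; linarith [h'.1]),
        if_neg h.ne, if_neg (by linarith)]
      ring
    · rw [if_pos ⟨h.ge, by linarith⟩, if_neg (by intro h'; linarith [h'.1]), if_pos h,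
        if_neg (by linarith)]
      ring
    · rcases lt_trichotomy (w * (k : ℝ)) z with h' | h' | h'
      · rw [if_pos ⟨h.le, h'⟩, if_pos ⟨h, h'.le⟩, if_neg h.ne', if_neg h'.ne]
        ring
      · rw [if_neg (by intro h''; linarith [h''.2]), if_pos ⟨h, h'.le⟩, if_neg h.ne', if_pos h']
        ring
      · rw [if_neg (by intro h''; linarith [h''.2]), if_neg (by intro h''; linarith [h''.2]),
          if_neg h.ne', if_neg h'.ne']
        ring
  have h1 := abs_le.mp (abs_sum_dyadic_sub_log_two_le hw hz hN)
  have h2 := sum_ite_mul_eq_le hw (half_pos hz) N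
  have h3 := sum_ite_mul_eq_le hw hz N
  have h4 : ∀ c : ℝ, 0 ≤ ∑ k ∈ Finset.Icc 1 N, (if w * k = c then (k : ℝ)⁻¹ else 0) :=
    fun c => Finset.sum_nonneg fun k _ => by split_ifs <;> positivity
  have h5 : w / (z / 2) = 2 * (w / z) := by field_simp
  have h6 := h4 z
  have h7 := h4 (z / 2)
  rw [hsplit, abs_le]
  constructor <;> linarith

/-- The difference of the indicators of the half-open dyadic ranges in `Cmlz`. -/
noncomputable def dyadicDiff (L z : ℝ) (d : ℕ) : ℝ :=
  (if L / 2 ≤ (d : ℝ) ∧ (d : ℝ) < L then 1 else 0) -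
    (if z / 2 < (d : ℝ) ∧ (d : ℝ) ≤ z then 1 else 0)

theorem abs_sum_dyadicDiff_le {L z : ℝ} (hL : 0 < L) (hLz : L ≤ 2 * z) {N : ℕ}
    (hLN : L ≤ N) (hzN : z ≤ N) {w : ℕ} (hw : 1 ≤ w) :
    |∑ k ∈ Finset.Icc 1 N, dyadicDiff L z (w * k) * (k : ℝ)⁻¹| ≤ 20 * min 1 (w / L) := by
  have hz : 0 < z := by linarith
  have hw1 : (1 : ℝ) ≤ w := by exact_mod_cast hw
  have hw0 : (0 : ℝ) < w := by linarith
  have hsplit : ∑ k ∈ Finset.Icc 1 N, dyadicDiff L z (w * k) * (k : ℝ)⁻¹ =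
      ∑ k ∈ Finset.Icc 1 N,
        (if L / 2 ≤ (w : ℝ) * k ∧ (w : ℝ) * k < L then (k : ℝ)⁻¹ else 0) -
      ∑ k ∈ Finset.Icc 1 N,
        (if z / 2 < (w : ℝ) * k ∧ (w : ℝ) * k ≤ z then (k : ℝ)⁻¹ else 0) := by
    rw [← Finset.sum_sub_distrib]
    refine Finset.sum_congr rfl fun k _ => ?_
    simp only [dyadicDiff, Nat.cast_mul, sub_mul, ite_mul, one_mul, zero_mul]
  have h1 := abs_le.mp (abs_sum_dyadic_left_closed_sub_log_two_le hw0 hL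
    ((div_le_self hL.le hw1).trans hLN))
  have h2 := abs_le.mp (abs_sum_dyadic_sub_log_two_le hw0 hz ((div_le_self hz.le hw1).trans hzN))
  have h3 : (w : ℝ) / z ≤ 2 * (w / L) := by
    rw [div_le_iff₀ hz]
    have : 2 * ((w : ℝ) / L) * z = w * ((2 * z) / L) := by ring
    rw [this]
    exact le_mul_of_one_le_right hw0.le ((one_le_div hL).mpr hLz)
  rw [hsplit]
  rcases le_or_gt (w : ℝ) L with hwL | hwL
  · rw [min_eq_right ((div_le_one hL).mpr hwL), abs_le]
    constructor <;> linarith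
  · rw [min_eq_left ((one_le_div hL).mpr hwL.le), Finset.sum_eq_zero, zero_sub, abs_neg]
    · rcases le_or_gt (w : ℝ) z with hwz | hwz
      · have h4 : (w : ℝ) / z ≤ 1 := (div_le_one hz).mpr hwz
        have := Real.log_two_lt_d9
        have := Real.log_two_gt_d9
        rw [abs_le]
        constructor <;> linarith
      · rw [Finset.sum_eq_zero]
        · norm_num
        · intro k hk
          have hk1 : (1 : ℝ) ≤ k := by exact_mod_cast (Finset.mem_Icc.mp hk).1
          exact if_neg fun h => by nlinarith [h.2]
    · intro k hk
      have hk1 : (1 : ℝ) ≤ k := by exact_mod_cast (Finset.mem_Icc.mp hk).1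
      exact if_neg fun h => by nlinarith [h.2]

theorem ite_coprime_inv_totient_eq {d m : ℕ} (hd : d ≠ 0) :
    (if d.Coprime m then (d.totient : ℝ)⁻¹ else 0) =
      (d : ℝ)⁻¹ * ∑ p ∈ d.divisorsAntidiagonal,
        (if p.1.Coprime m then invTotientSqfree p.1 else 0) *
          (if p.2.Coprime m then 1 else 0) := by
  have hd' : (d : ℝ) ≠ 0 := by exact_mod_cast hd
  have hterm : ∑ p ∈ d.divisorsAntidiagonal,
        (if p.1.Coprime m then invTotientSqfree p.1 else 0) *
          (if p.2.Coprime m then (1 : ℝ) else 0) =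
      ∑ p ∈ d.divisorsAntidiagonal, if d.Coprime m then invTotientSqfree p.1 else 0 := by
    refine Finset.sum_congr rfl fun p hp => ?_
    have hc : d.Coprime m ↔ p.1.Coprime m ∧ p.2.Coprime m := by
      rw [← (Nat.mem_divisorsAntidiagonal.mp hp).1, Nat.coprime_mul_iff_left]
    by_cases h1 : p.1.Coprime m
    · by_cases h2 : p.2.Coprime m
      · rw [if_pos h1, if_pos h2, if_pos (hc.mpr ⟨h1, h2⟩), mul_one]
      · rw [if_neg h2, if_neg fun h => h2 (hc.mp h).2, mul_zero]
    · rw [if_neg h1, if_neg fun h => h1 (hc.mp h).1, zero_mul]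
  rw [hterm]
  split_ifs
  · rw [Nat.sum_divisorsAntidiagonal (fun b _ => invTotientSqfree b),
      sum_divisors_invTotientSqfree hd]
    field_simp
  · simp

theorem Cmlz_eq_sum_dyadicDiff (m : ℕ) {L z : ℝ} {N : ℕ} (hL : ⌈L⌉₊ ≤ N) (hz : ⌈z⌉₊ ≤ N) :
    Cmlz m L z = ∑ d ∈ Finset.Icc 1 N,
      dyadicDiff L z d * (if d.Coprime m then (d.totient : ℝ)⁻¹ else 0) := by
  unfold Cmlz dyadicDiff
  simp_rw [sub_mul]
  rw [Finset.sum_sub_distrib]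
  congr 1
  · rw [Finset.sum_filter, ← Finset.sum_subset (Finset.Icc_subset_Icc_right hL)]
    · refine Finset.sum_congr rfl fun d _ => ?_
      by_cases h1 : L / 2 ≤ (d : ℝ) ∧ (d : ℝ) < L <;> by_cases h2 : d.Coprime m <;>
        simp [h1, h2, ← and_assoc]
    · intro d hd hd'
      rw [if_neg, zero_mul]
      intro h
      refine hd' (Finset.mem_Icc.mpr ⟨(Finset.mem_Icc.mp hd).1, ?_⟩)
      exact_mod_cast h.2.le.trans (Nat.le_ceil L)
  · rw [Finset.sum_filter, ← Finset.sum_subset (Finset.Icc_subset_Icc_right hz)]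
    · refine Finset.sum_congr rfl fun d _ => ?_
      by_cases h1 : z / 2 < (d : ℝ) ∧ (d : ℝ) ≤ z <;> by_cases h2 : d.Coprime m <;>
        simp [h1, h2, ← and_assoc]
    · intro d hd hd'
      rw [if_neg, zero_mul]
      intro h
      refine hd' (Finset.mem_Icc.mpr ⟨(Finset.mem_Icc.mp hd).1, ?_⟩)
      exact_mod_cast h.2.trans (Nat.le_ceil z)

theorem dyadicDiff_eq_zero {L z : ℝ} {N d : ℕ} (hL : L ≤ N) (hz : z ≤ N) (hd : N < d) :
    dyadicDiff L z d = 0 := by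
  have hd' : (N : ℝ) < d := by exact_mod_cast hd
  unfold dyadicDiff
  rw [if_neg (by intro h; linarith [h.2]), if_neg (by intro h; linarith [h.2]), sub_zero]

theorem Cmlz_eq_triple_sum {m : ℕ} (hm : m ≠ 0) {L z : ℝ} {N : ℕ} (hL : ⌈L⌉₊ ≤ N)
    (hz : ⌈z⌉₊ ≤ N) :
    Cmlz m L z = ∑ b ∈ Finset.Icc 1 N, ∑ e ∈ Finset.Icc 1 N,
      ((if b.Coprime m then invTotientSqfree b else 0) * (b : ℝ)⁻¹) *
        (((if e ∣ m then (ArithmeticFunction.moebius e : ℝ) else 0) * (e : ℝ)⁻¹) *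
          ∑ k ∈ Finset.Icc 1 N, dyadicDiff L z (b * e * k) * (k : ℝ)⁻¹) := by
  have hLN : L ≤ N := Nat.ceil_le.mp hL
  have hzN : z ≤ N := Nat.ceil_le.mp hz
  rw [Cmlz_eq_sum_dyadicDiff m hL hz]
  have h1 : ∀ d ∈ Finset.Icc 1 N,
      dyadicDiff L z d * (if d.Coprime m then (d.totient : ℝ)⁻¹ else 0) =
      (dyadicDiff L z d * (d : ℝ)⁻¹) * ∑ p ∈ d.divisorsAntidiagonal,
        (if p.1.Coprime m then invTotientSqfree p.1 else 0) *
          (if p.2.Coprime m then 1 else 0) := fun d hd => by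
    rw [ite_coprime_inv_totient_eq (Nat.one_le_iff_ne_zero.mp (Finset.mem_Icc.mp hd).1), mul_assoc]
  rw [Finset.sum_congr rfl h1, sum_mul_sum_divisorsAntidiagonal N
    (fun d => dyadicDiff L z d * (d : ℝ)⁻¹)
    (fun b => if b.Coprime m then invTotientSqfree b else 0)
    (fun q => if q.Coprime m then 1 else 0)
    (fun d hd => by rw [dyadicDiff_eq_zero hLN hzN hd, zero_mul])]
  refine Finset.sum_congr rfl fun b hb => ?_
  have hb1 : 1 ≤ b := (Finset.mem_Icc.mp hb).1
  have h2 : ∀ q ∈ Finset.Icc 1 N,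
      (dyadicDiff L z (b * q) * ((b * q : ℕ) : ℝ)⁻¹) *
        ((if b.Coprime m then invTotientSqfree b else 0) * (if q.Coprime m then 1 else 0)) =
      ((if b.Coprime m then invTotientSqfree b else 0) *
        (dyadicDiff L z (b * q) * ((b * q : ℕ) : ℝ)⁻¹)) * ∑ p ∈ q.divisorsAntidiagonal,
          (if p.1 ∣ m then (ArithmeticFunction.moebius p.1 : ℝ) else 0) * 1 := fun q hq => by
    have hq0 : q ≠ 0 := Nat.one_le_iff_ne_zero.mp (Finset.mem_Icc.mp hq).1
    simp_rw [mul_one]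
    rw [Nat.sum_divisorsAntidiagonal
      (fun e _ => if e ∣ m then (ArithmeticFunction.moebius e : ℝ) else 0), sum_moebius_dvd hm hq0]
    ring
  rw [Finset.sum_congr rfl h2, sum_mul_sum_divisorsAntidiagonal N
    (fun q => (if b.Coprime m then invTotientSqfree b else 0) *
        (dyadicDiff L z (b * q) * ((b * q : ℕ) : ℝ)⁻¹))
    (fun e => if e ∣ m then (ArithmeticFunction.moebius e : ℝ) else 0) (fun _ => 1)
    (fun q hq => by
      rw [dyadicDiff_eq_zero hLN hzN (lt_of_lt_of_le hq (Nat.le_mul_of_pos_left q hb1)),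
        zero_mul, mul_zero])]
  refine Finset.sum_congr rfl fun e _ => ?_
  rw [Finset.mul_sum, Finset.mul_sum]
  refine Finset.sum_congr rfl fun k _ => ?_
  rw [← mul_assoc b e k]
  push_cast
  rw [mul_inv, mul_inv]
  ring

theorem abs_Cmlz_le_tau_mul_sum {m : ℕ} (hm : m ≠ 0) {L z : ℝ} (hL0 : 0 < L) (hLz : L ≤ 2 * z)
    {N : ℕ} (hL : ⌈L⌉₊ ≤ N) (hz : ⌈z⌉₊ ≤ N) :
    |Cmlz m L z| ≤ 20 * (tau m : ℝ) *
      ∑ b ∈ Finset.Icc 1 N, min (b : ℝ)⁻¹ L⁻¹ * (b.totient : ℝ)⁻¹ := by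
  rw [Cmlz_eq_triple_sum hm hL hz]
  have hterm : ∀ b ∈ Finset.Icc 1 N, ∀ e ∈ Finset.Icc 1 N,
      |((if b.Coprime m then invTotientSqfree b else 0) * (b : ℝ)⁻¹) *
        (((if e ∣ m then (ArithmeticFunction.moebius e : ℝ) else 0) * (e : ℝ)⁻¹) *
          ∑ k ∈ Finset.Icc 1 N, dyadicDiff L z (b * e * k) * (k : ℝ)⁻¹)| ≤
      (20 * (min (b : ℝ)⁻¹ L⁻¹ * (b.totient : ℝ)⁻¹)) * (if e ∣ m then 1 else 0) := by
    intro b hb e he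
    have hb1 := (Finset.mem_Icc.mp hb).1
    have he1 := (Finset.mem_Icc.mp he).1
    have hbR : (1 : ℝ) ≤ b := by exact_mod_cast hb1
    have heR : (1 : ℝ) ≤ e := by exact_mod_cast he1
    have hW : |if b.Coprime m then invTotientSqfree b else 0| ≤ (b.totient : ℝ)⁻¹ := by
      split_ifs
      · rw [abs_of_nonneg (invTotientSqfree_nonneg b)]; exact invTotientSqfree_le b
      · rw [abs_zero]; positivity
    have hU : |if e ∣ m then (ArithmeticFunction.moebius e : ℝ) else 0| ≤
        if e ∣ m then 1 else 0 := by
      split_ifs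
      · exact_mod_cast ArithmeticFunction.abs_moebius_le_one
      · simp
    have hS := abs_sum_dyadicDiff_le hL0 hLz (Nat.ceil_le.mp hL) (Nat.ceil_le.mp hz)
      (Nat.mul_pos hb1 he1)
    have hmin : (b : ℝ)⁻¹ * (e : ℝ)⁻¹ * min 1 (((b * e : ℕ) : ℝ) / L) ≤ min (b : ℝ)⁻¹ L⁻¹ := by
      have hp : 0 ≤ (b : ℝ)⁻¹ * (e : ℝ)⁻¹ := by positivity
      refine le_min ?_ ?_
      · calc _ ≤ (b : ℝ)⁻¹ * (e : ℝ)⁻¹ * 1 := mul_le_mul_of_nonneg_left (min_le_left _ _) hp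
          _ ≤ (b : ℝ)⁻¹ * 1 * 1 := by gcongr; exact inv_le_one_of_one_le₀ heR
          _ = _ := by ring
      · calc _ ≤ (b : ℝ)⁻¹ * (e : ℝ)⁻¹ * (((b * e : ℕ) : ℝ) / L) :=
              mul_le_mul_of_nonneg_left (min_le_right _ _) hp
          _ = _ := by push_cast; field_simp
    have hI : (0 : ℝ) ≤ if e ∣ m then 1 else 0 := by split_ifs <;> norm_num
    rw [abs_mul, abs_mul, abs_mul, abs_mul, abs_of_nonneg (show 0 ≤ (b : ℝ)⁻¹ by positivity),
      abs_of_nonneg (show 0 ≤ (e : ℝ)⁻¹ by positivity)]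
    calc _ ≤ ((b.totient : ℝ)⁻¹ * (b : ℝ)⁻¹) * (((if e ∣ m then 1 else 0) * (e : ℝ)⁻¹) *
          (20 * min 1 (((b * e : ℕ) : ℝ) / L))) := by gcongr
      _ = (20 * (b.totient : ℝ)⁻¹ * (if e ∣ m then 1 else 0)) *
          ((b : ℝ)⁻¹ * (e : ℝ)⁻¹ * min 1 (((b * e : ℕ) : ℝ) / L)) := by ring
      _ ≤ (20 * (b.totient : ℝ)⁻¹ * (if e ∣ m then 1 else 0)) * min (b : ℝ)⁻¹ L⁻¹ := by
          gcongr
      _ = _ := by ring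
  have hcount : ∑ e ∈ Finset.Icc 1 N, (if e ∣ m then (1 : ℝ) else 0) ≤ tau m := by
    rw [← Finset.sum_filter, Finset.sum_const, nsmul_one, tau]
    refine Nat.cast_le.mpr (Finset.card_le_card fun e he => ?_)
    exact Nat.mem_divisors.mpr ⟨(Finset.mem_filter.mp he).2, hm⟩
  calc _ ≤ ∑ b ∈ Finset.Icc 1 N, ∑ e ∈ Finset.Icc 1 N,
        (20 * (min (b : ℝ)⁻¹ L⁻¹ * (b.totient : ℝ)⁻¹)) * (if e ∣ m then 1 else 0) := by
        refine (Finset.abs_sum_le_sum_abs _ _).trans (Finset.sum_le_sum fun b hb => ?_)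
        exact (Finset.abs_sum_le_sum_abs _ _).trans (Finset.sum_le_sum (hterm b hb))
    _ ≤ ∑ b ∈ Finset.Icc 1 N, (20 * (min (b : ℝ)⁻¹ L⁻¹ * (b.totient : ℝ)⁻¹)) * tau m := by
        refine Finset.sum_le_sum fun b _ => ?_
        rw [← Finset.mul_sum]
        exact mul_le_mul_of_nonneg_left hcount (by positivity)
    _ = _ := by
        rw [← Finset.sum_mul, ← Finset.mul_sum]
        ring

theorem exists_sum_inv_mul_totient_le :
    ∃ A : ℝ, 0 < A ∧ ∀ N : ℕ,
      ∑ b ∈ Finset.Icc 1 N, (b : ℝ)⁻¹ * (b.totient : ℝ)⁻¹ ≤ A := by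
  have hs : Summable fun b : ℕ => 2 * ((b : ℝ) ^ (3 / 2 : ℝ))⁻¹ :=
    (Real.summable_nat_rpow_inv.mpr (by norm_num)).mul_left 2
  refine ⟨∑' b : ℕ, 2 * ((b : ℝ) ^ (3 / 2 : ℝ))⁻¹ + 1, ?_, fun N => ?_⟩
  · have : 0 ≤ ∑' b : ℕ, 2 * ((b : ℝ) ^ (3 / 2 : ℝ))⁻¹ := tsum_nonneg fun b => by positivity
    linarith
  · refine le_trans (Finset.sum_le_sum fun b hb => ?_)
      ((hs.sum_le_tsum (Finset.Icc 1 N) fun b _ => by positivity).trans (by linarith))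
    have hb1 : 1 ≤ b := (Finset.mem_Icc.mp hb).1
    have hb0 : (0 : ℝ) < b := by exact_mod_cast hb1
    have h1 := sqrt_le_two_mul_totient b
    have h2 : (0 : ℝ) < b.totient := by exact_mod_cast Nat.totient_pos.mpr hb1
    have h3 : (b : ℝ) ^ (3 / 2 : ℝ) = b * Real.sqrt b := by
      rw [Real.sqrt_eq_rpow, show (3 / 2 : ℝ) = 1 + 1 / 2 by norm_num, Real.rpow_add hb0,
        Real.rpow_one]
    have hsq : 0 < Real.sqrt b := Real.sqrt_pos.mpr hb0
    rw [h3, ← mul_inv, ← div_eq_mul_inv, inv_eq_one_div,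
      div_le_div_iff₀ (by positivity) (by positivity)]
    nlinarith

theorem sum_inv_mul_min_le {L : ℕ} (hL : 1 ≤ L) (N : ℕ) :
    ∑ k ∈ Finset.Icc 1 N, (k : ℝ)⁻¹ * min (k : ℝ)⁻¹ (L : ℝ)⁻¹ ≤ (2 + Real.log L) / L := by
  have hL0 : (0 : ℝ) < L := by exact_mod_cast hL
  have hnn : ∀ k : ℕ, 0 ≤ (k : ℝ)⁻¹ * min (k : ℝ)⁻¹ (L : ℝ)⁻¹ := fun k => by positivity
  calc _ ≤ ∑ k ∈ Finset.Icc 1 L ∪ Finset.Ioc L (max L N),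
          (k : ℝ)⁻¹ * min (k : ℝ)⁻¹ (L : ℝ)⁻¹ := by
        refine Finset.sum_le_sum_of_subset_of_nonneg (fun k hk => ?_) fun k _ _ => hnn k
        simp only [Finset.mem_union, Finset.mem_Icc, Finset.mem_Ioc] at hk ⊢
        omega
    _ = ∑ k ∈ Finset.Icc 1 L, (k : ℝ)⁻¹ * min (k : ℝ)⁻¹ (L : ℝ)⁻¹ +
          ∑ k ∈ Finset.Ioc L (max L N), (k : ℝ)⁻¹ * min (k : ℝ)⁻¹ (L : ℝ)⁻¹ := by
        refine Finset.sum_union (Finset.disjoint_left.mpr fun k hk hk' => ?_)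
        simp only [Finset.mem_Icc, Finset.mem_Ioc] at hk hk'
        omega
    _ ≤ ∑ k ∈ Finset.Icc 1 L, (k : ℝ)⁻¹ * (L : ℝ)⁻¹ +
          ∑ k ∈ Finset.Ioc L (max L N), ((k : ℝ) ^ 2)⁻¹ := by
        refine add_le_add (Finset.sum_le_sum fun k _ => ?_) (Finset.sum_le_sum fun k _ => ?_)
        · exact mul_le_mul_of_nonneg_left (min_le_right _ _) (by positivity)
        · rw [sq, mul_inv]
          exact mul_le_mul_of_nonneg_left (min_le_left _ _) (by positivity)
    _ ≤ (1 + Real.log L) * (L : ℝ)⁻¹ + (L : ℝ)⁻¹ := by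
        refine add_le_add ?_ ?_
        · rw [← Finset.sum_mul]
          refine mul_le_mul_of_nonneg_right ?_ (by positivity)
          have h := harmonic_le_one_add_log L
          rw [harmonic_eq_sum_Icc] at h
          push_cast at h
          exact h
        · refine (sum_Ioc_inv_sq_le_sub (by omega) (le_max_left L N)).trans ?_
          have : (0 : ℝ) ≤ ((max L N : ℕ) : ℝ)⁻¹ := by positivity
          linarith
    _ = _ := by ring

theorem sum_min_mul_inv_totient_le {A : ℝ}
    (hA : ∀ N : ℕ, ∑ b ∈ Finset.Icc 1 N, (b : ℝ)⁻¹ * (b.totient : ℝ)⁻¹ ≤ A)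
    {L : ℕ} (hL : 1 ≤ L) (N : ℕ) :
    ∑ b ∈ Finset.Icc 1 N, min (b : ℝ)⁻¹ (L : ℝ)⁻¹ * (b.totient : ℝ)⁻¹ ≤
      A * ((2 + Real.log L) / L) := by
  set G : ℕ → ℝ := fun d => if d ≤ N then min (d : ℝ)⁻¹ (L : ℝ)⁻¹ * (d : ℝ)⁻¹ else 0 with hG
  have h1 : ∀ d ∈ Finset.Icc 1 N, min (d : ℝ)⁻¹ (L : ℝ)⁻¹ * (d.totient : ℝ)⁻¹ =
      G d * ∑ p ∈ d.divisorsAntidiagonal, invTotientSqfree p.1 * 1 := fun d hd => by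
    obtain ⟨hd1, hdN⟩ := Finset.mem_Icc.mp hd
    have hd0 : (d : ℝ) ≠ 0 := by exact_mod_cast Nat.one_le_iff_ne_zero.mp hd1
    simp_rw [mul_one]
    rw [Nat.sum_divisorsAntidiagonal (fun b _ => invTotientSqfree b),
      sum_divisors_invTotientSqfree (Nat.one_le_iff_ne_zero.mp hd1), hG]
    simp only [if_pos hdN]
    field_simp
  rw [Finset.sum_congr rfl h1, sum_mul_sum_divisorsAntidiagonal N G invTotientSqfree (fun _ => 1)
    (fun d hd => if_neg (not_le.mpr hd))]
  calc _ ≤ ∑ b ∈ Finset.Icc 1 N, ∑ k ∈ Finset.Icc 1 N,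
        ((b : ℝ)⁻¹ * (b.totient : ℝ)⁻¹) * ((k : ℝ)⁻¹ * min (k : ℝ)⁻¹ (L : ℝ)⁻¹) := by
        refine Finset.sum_le_sum fun b hb => Finset.sum_le_sum fun k hk => ?_
        have hb1 : (1 : ℝ) ≤ b := by exact_mod_cast (Finset.mem_Icc.mp hb).1
        have hk1 : (1 : ℝ) ≤ k := by exact_mod_cast (Finset.mem_Icc.mp hk).1
        have hGle : G (b * k) ≤ (b : ℝ)⁻¹ * ((k : ℝ)⁻¹ * min (k : ℝ)⁻¹ (L : ℝ)⁻¹) := by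
          simp only [hG]
          split_ifs
          · have : (((b * k : ℕ) : ℝ))⁻¹ ≤ (k : ℝ)⁻¹ := by
              push_cast
              gcongr
              nlinarith
            calc _ ≤ min (k : ℝ)⁻¹ (L : ℝ)⁻¹ * (((b * k : ℕ) : ℝ))⁻¹ := by gcongr
              _ = _ := by push_cast; rw [mul_inv]; ring
          · positivity
        rw [mul_one]
        calc _ ≤ (b : ℝ)⁻¹ * ((k : ℝ)⁻¹ * min (k : ℝ)⁻¹ (L : ℝ)⁻¹) * (b.totient : ℝ)⁻¹ :=
              mul_le_mul hGle (invTotientSqfree_le b) (invTotientSqfree_nonneg b) (by positivity)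
          _ = _ := by ring
    _ = (∑ b ∈ Finset.Icc 1 N, (b : ℝ)⁻¹ * (b.totient : ℝ)⁻¹) *
        ∑ k ∈ Finset.Icc 1 N, (k : ℝ)⁻¹ * min (k : ℝ)⁻¹ (L : ℝ)⁻¹ := by
        rw [Finset.sum_mul_sum]
    _ ≤ _ := mul_le_mul (hA N) (sum_inv_mul_min_le hL N)
        (Finset.sum_nonneg fun k _ => by positivity)
        ((Finset.sum_nonneg fun b _ => by positivity).trans (hA N))

theorem exists_abs_Cmlz_le :
    ∃ A : ℝ, 0 < A ∧ ∀ (m L : ℕ) (z : ℝ), m ≠ 0 → 1 ≤ L → (L : ℝ) ≤ 2 * z →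
      |Cmlz m L z| ≤ A * (tau m : ℝ) * ((2 + Real.log L) / L) := by
  obtain ⟨A, hA0, hA⟩ := exists_sum_inv_mul_totient_le
  refine ⟨20 * A, by positivity, fun m L z hm hL hLz => ?_⟩
  have hL0 : (0 : ℝ) < L := by exact_mod_cast hL
  refine (abs_Cmlz_le_tau_mul_sum hm hL0 hLz (le_max_left ⌈(L : ℝ)⌉₊ ⌈z⌉₊)
    (le_max_right _ _)).trans ?_
  calc _ ≤ 20 * (tau m : ℝ) * (A * ((2 + Real.log L) / L)) :=
        mul_le_mul_of_nonneg_left (sum_min_mul_inv_totient_le hA hL _) (by positivity)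
    _ = _ := by ring

theorem sum_Shl_le {x Q B : ℝ} (hx : 0 ≤ x) (hQ : 0 < Q) {h : ℕ} (hh : 1 ≤ h) (l : ℕ)
    {f : ℕ → ℝ} (hf : ∀ n, 0 ≤ f n)
    (hB : ∀ y : ℝ, ∑ n ∈ (Finset.Icc 1 ⌊x⌋₊).filter
      (fun n : ℕ => y < (n : ℝ) ∧ (n : ℝ) ≤ y + Q / 2), f n ≤ B) :
    ∑ p ∈ Shl x Q h l, f p.1 * f p.2 ≤ (∑ n ∈ Finset.Icc 1 ⌊x⌋₊, f n) * (2 * B) := by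
  have hxh : ⌊x / h⌋₊ ≤ ⌊x⌋₊ :=
    Nat.floor_mono (div_le_self hx (by exact_mod_cast hh))
  have hclosed : ∀ y : ℝ, ∑ n ∈ (Finset.Icc 1 ⌊x⌋₊).filter
      (fun n : ℕ => y ≤ (n : ℝ) ∧ (n : ℝ) ≤ y + Q / 2), f n ≤ 2 * B := fun y => by
    have h1 := hB y
    have h2 := hB (y - Q / 2)
    rw [Finset.sum_filter] at h1 h2 ⊢
    refine le_trans (Finset.sum_le_sum fun n _ => ?_)
      (Finset.sum_add_distrib.trans_le ((add_le_add h1 h2).trans_eq (two_mul B).symm))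
    have := hf n
    rcases lt_trichotomy y n with h | h | h
    · by_cases h' : (n : ℝ) ≤ y + Q / 2
      · rw [if_pos ⟨h.le, h'⟩, if_pos ⟨h, h'⟩]
        split_ifs <;> linarith
      · rw [if_neg fun h'' => h' h''.2]
        split_ifs <;> linarith
    · rw [if_pos (c := y - Q / 2 < (n : ℝ) ∧ (n : ℝ) ≤ y - Q / 2 + Q / 2)
        ⟨by linarith, by linarith⟩]
      split_ifs <;> linarith
    · rw [if_neg fun h'' => h''.1.not_gt h]
      split_ifs <;> linarith
  calc _ ≤ ∑ p ∈ (Finset.Icc 1 ⌊x⌋₊ ×ˢ Finset.Icc 1 ⌊x⌋₊).filter (fun p : ℕ × ℕ =>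
          (p.1 : ℝ) - ((l : ℝ) + 1) * Q / 2 ≤ (p.2 : ℝ) ∧
          (p.2 : ℝ) ≤ (p.1 : ℝ) - ((l : ℝ) + 1) * Q / 2 + Q / 2), f p.1 * f p.2 := by
        refine Finset.sum_le_sum_of_subset_of_nonneg (fun p hp => ?_)
          fun p _ _ => mul_nonneg (hf _) (hf _)
        simp only [Shl, Finset.mem_filter, Finset.mem_product, Finset.mem_Icc] at hp ⊢
        obtain ⟨⟨⟨h1, h2⟩, h3, h4⟩, -, h5, h6⟩ := hp
        exact ⟨⟨⟨h1, h2.trans hxh⟩, h3, h4.trans hxh⟩, by linarith, by linarith⟩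
    _ = ∑ n₁ ∈ Finset.Icc 1 ⌊x⌋₊, f n₁ * ∑ n₂ ∈ (Finset.Icc 1 ⌊x⌋₊).filter
        (fun n : ℕ => (n₁ : ℝ) - ((l : ℝ) + 1) * Q / 2 ≤ (n : ℝ) ∧
          (n : ℝ) ≤ (n₁ : ℝ) - ((l : ℝ) + 1) * Q / 2 + Q / 2), f n₂ := by
        rw [Finset.sum_filter, Finset.sum_product]
        refine Finset.sum_congr rfl fun n₁ _ => ?_
        rw [← Finset.sum_filter, Finset.mul_sum]
    _ ≤ ∑ n₁ ∈ Finset.Icc 1 ⌊x⌋₊, f n₁ * (2 * B) :=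
        Finset.sum_le_sum fun n₁ _ => mul_le_mul_of_nonneg_left (hclosed _) (hf n₁)
    _ = _ := by rw [Finset.sum_mul]

theorem sum_sum_abs_mul_tau_le {M H : ℕ} (hH : H ≤ M) (a : ℕ → ℝ) (ha : ∀ n, M < n → a n = 0) :
    ∑ h ∈ Finset.Icc 1 H, ∑ n ∈ Finset.Icc 1 M, |a (n * h)| * (tau n : ℝ) ≤
      ∑ n ∈ Finset.Icc 1 M, |a n| * (tau3 n : ℝ) := by
  calc _ ≤ ∑ h ∈ Finset.Icc 1 M, ∑ n ∈ Finset.Icc 1 M, |a (n * h)| * (tau n : ℝ) :=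
        Finset.sum_le_sum_of_subset_of_nonneg (Finset.Icc_subset_Icc_right hH)
          fun h _ _ => Finset.sum_nonneg fun n _ => by positivity
    _ = ∑ h ∈ Finset.Icc 1 M, ∑ n ∈ Finset.Icc 1 M, |a (h * n)| * (1 * (tau n : ℝ)) := by
        simp_rw [one_mul, mul_comm]
    _ = ∑ d ∈ Finset.Icc 1 M, |a d| * ∑ p ∈ d.divisorsAntidiagonal, 1 * (tau p.2 : ℝ) :=
        (sum_mul_sum_divisorsAntidiagonal M (fun d => |a d|) (fun _ => 1) (fun n => (tau n : ℝ))
          fun d hd => by rw [ha d hd, abs_zero]).symm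
    _ ≤ _ := by
        refine Finset.sum_le_sum fun d hd => mul_le_mul_of_nonneg_left ?_ (abs_nonneg _)
        simp_rw [one_mul]
        exact_mod_cast sum_tau_le_tau3 (Nat.one_le_iff_ne_zero.mp (Finset.mem_Icc.mp hd).1)

theorem one_le_log_two_add {t : ℝ} (ht : 1 ≤ t) : 1 ≤ Real.log (2 + t) := by
  rw [Real.le_log_iff_exp_le (by linarith)]
  linarith [Real.exp_one_lt_d9]

theorem log_le_two_mul_log_two_add {t u : ℝ} (ht : 1 ≤ t) (hu : 0 < u) (hut : u ≤ 2 * t + 1) :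
    Real.log u ≤ 2 * Real.log (2 + t) := by
  calc Real.log u ≤ Real.log ((2 + t) ^ 2) := Real.log_le_log hu (by nlinarith)
    _ = _ := by rw [Real.log_pow]; norm_num

/-- The main estimate in the proof of Theorem 1: if `√(2x) < Q ≤ x` are large and the real
sequence `(a_n)_{n ≤ x}` satisfies the Hereditarily Sparse condition with parameter
`K_hered > 0`, then
`|Σ_{h ≤ 2x/Q} Σ_{0 ≤ l ≤ 2x/(Qh)} Σ_{(n₁,n₂) ∈ 𝒮_{h,l}} a_{n₁h} a_{n₂h} C_{n₁n₂,l+1,Q/h}|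
  ≪ log²(2 + x/Q) (Σ_{n ≤ x} |a_n|)² / K_hered`, with an absolute implied constant. -/
theorem statement_11 :
    ∃ C : ℝ, 0 < C ∧ ∀ (x Q Khered : ℝ) (a : ℕ → ℝ),
      C ≤ x → Real.sqrt (2 * x) < Q → Q ≤ x →
      (∀ n : ℕ, x < n → a n = 0) →
      0 < Khered →
      (∀ h : ℕ, 1 ≤ h → (h : ℝ) ≤ 2 * x / Q → ∀ y : ℝ,
        ∑ n ∈ (Finset.Icc 1 ⌊x⌋₊).filter (fun n : ℕ => y < (n : ℝ) ∧ (n : ℝ) ≤ y + Q / 2),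
            |a (n * h)| * (tau n : ℝ)
          ≤ (1 / Khered) * (∑ n ∈ Finset.Icc 1 ⌊x⌋₊, |a n|) ^ 2 /
              (∑ n ∈ Finset.Icc 1 ⌊x⌋₊, |a n| * (tau3 n : ℝ))) →
      |∑ h ∈ Finset.Icc 1 ⌊2 * x / Q⌋₊, ∑ l ∈ Finset.range (⌊2 * x / (Q * h)⌋₊ + 1),
          ∑ p ∈ Shl x Q h l, a (p.1 * h) * a (p.2 * h) * Cmlz (p.1 * p.2) ((l : ℝ) + 1) (Q / h)|
        ≤ C * (Real.log (2 + x / Q)) ^ 2 * (∑ n ∈ Finset.Icc 1 ⌊x⌋₊, |a n|) ^ 2 / Khered := by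
  obtain ⟨A, hA0, hA⟩ := exists_abs_Cmlz_le
  refine ⟨24 * A, by positivity, fun x Q K a hCx hsqrt hQx ha hK hered => ?_⟩
  have hx : 0 < x := lt_of_lt_of_le (by positivity) hCx
  have hQ : 0 < Q := lt_of_le_of_lt (Real.sqrt_nonneg _) hsqrt
  have hQ2 : 2 * x < Q ^ 2 := (Real.sqrt_lt' hQ).mp hsqrt
  have hxQ : 2 * x / Q < Q := by rw [div_lt_iff₀ hQ]; nlinarith
  have ht : 1 ≤ x / Q := (one_le_div hQ).mpr hQx
  set Λ := Real.log (2 + x / Q) with hΛ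
  have hΛ1 : 1 ≤ Λ := one_le_log_two_add ht
  set M := ⌊x⌋₊ with hM
  set S := ∑ n ∈ Finset.Icc 1 M, |a n| with hS
  set T := ∑ n ∈ Finset.Icc 1 M, |a n| * (tau3 n : ℝ) with hT
  set B := (1 / K) * S ^ 2 / T with hB
  have hT0 : 0 ≤ T := Finset.sum_nonneg fun n _ => by positivity
  have hB0 : 0 ≤ B := by positivity
  have haM : ∀ n, M < n → a n = 0 := fun n hn => ha n ((Nat.floor_lt hx.le).mp hn)
  have hHM : ⌊2 * x / Q⌋₊ ≤ M := Nat.floor_mono (hxQ.le.trans hQx)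
  have hBT : B * T ≤ S ^ 2 / K := by
    rcases hT0.eq_or_lt with h0 | h0
    · rw [← h0, mul_zero]; positivity
    · rw [hB, div_mul_cancel₀ _ h0.ne']
      exact le_of_eq (by ring)
  set F : ℕ → ℝ := fun h => ∑ n ∈ Finset.Icc 1 M, |a (n * h)| * (tau n : ℝ) with hF
  have hF0 : ∀ h, 0 ≤ F h := fun h => Finset.sum_nonneg fun n _ => by positivity
  have hFT : ∑ h ∈ Finset.Icc 1 ⌊2 * x / Q⌋₊, F h ≤ T := sum_sum_abs_mul_tau_le hHM a haM
  have hfloor : ∀ h : ℕ, 1 ≤ h → ∀ l ≤ ⌊2 * x / (Q * h)⌋₊,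
      (l : ℝ) ≤ Q / h ∧ (l : ℝ) + 1 ≤ 2 * (x / Q) + 1 := by
    intro h hh l hl
    have hh0 : (1 : ℝ) ≤ h := by exact_mod_cast hh
    have hl' : (l : ℝ) ≤ 2 * x / Q / h := by
      rw [div_div]
      exact (Nat.le_floor_iff (by positivity)).mp hl
    refine ⟨hl'.trans (by gcongr), ?_⟩
    have := hl'.trans (div_le_self (by positivity) hh0)
    rw [mul_div_assoc] at this
    linarith
  have hterm : ∀ h ∈ Finset.Icc 1 ⌊2 * x / Q⌋₊, ∀ l ∈ Finset.range (⌊2 * x / (Q * h)⌋₊ + 1),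
      |∑ p ∈ Shl x Q h l, a (p.1 * h) * a (p.2 * h) * Cmlz (p.1 * p.2) ((l : ℝ) + 1) (Q / h)| ≤
        8 * A * Λ * B * F h * ((l : ℝ) + 1)⁻¹ := by
    intro h hh l hl
    obtain ⟨hh1, hhH⟩ := Finset.mem_Icc.mp hh
    have hhx : (h : ℝ) ≤ 2 * x / Q := (Nat.le_floor_iff (by positivity)).mp hhH
    have hh0 : (0 : ℝ) < h := by exact_mod_cast hh1
    obtain ⟨hlz, hlt⟩ := hfloor h hh1 l (Nat.lt_succ_iff.mp (Finset.mem_range.mp hl))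
    have hz1 : 1 ≤ Q / h := (one_le_div hh0).mpr (hhx.trans hxQ.le)
    have hlog := log_le_two_mul_log_two_add ht (by positivity) hlt
    have hp : ∀ p ∈ Shl x Q h l,
        |a (p.1 * h) * a (p.2 * h) * Cmlz (p.1 * p.2) ((l : ℝ) + 1) (Q / h)| ≤
        (A * (4 * Λ * ((l : ℝ) + 1)⁻¹)) *
          ((|a (p.1 * h)| * (tau p.1 : ℝ)) * (|a (p.2 * h)| * (tau p.2 : ℝ))) := by
      intro p hp
      simp only [Shl, Finset.mem_filter, Finset.mem_product, Finset.mem_Icc] at hp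
      have hC := hA (p.1 * p.2) (l + 1) (Q / h)
        (Nat.mul_pos hp.1.1.1 hp.1.2.1).ne' (Nat.le_add_left 1 l) (by push_cast; linarith)
      push_cast at hC
      have htau : (tau (p.1 * p.2) : ℝ) ≤ tau p.1 * tau p.2 := by
        exact_mod_cast tau_mul_le p.1 p.2
      have hC' : |Cmlz (p.1 * p.2) ((l : ℝ) + 1) (Q / h)| ≤
          A * (tau p.1 * tau p.2) * (4 * Λ * ((l : ℝ) + 1)⁻¹) := by
        refine hC.trans ?_
        rw [div_eq_mul_inv]
        have h4 : 2 + Real.log ((l : ℝ) + 1) ≤ 4 * Λ := by linarith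
        have h5 : 0 ≤ Real.log ((l : ℝ) + 1) :=
          Real.log_nonneg (le_add_of_nonneg_left (Nat.cast_nonneg l))
        gcongr
      rw [abs_mul, abs_mul]
      calc _ ≤ |a (p.1 * h)| * |a (p.2 * h)| *
            (A * (tau p.1 * tau p.2) * (4 * Λ * ((l : ℝ) + 1)⁻¹)) := by gcongr
        _ = _ := by ring
    calc _ ≤ ∑ p ∈ Shl x Q h l, (A * (4 * Λ * ((l : ℝ) + 1)⁻¹)) *
          ((|a (p.1 * h)| * (tau p.1 : ℝ)) * (|a (p.2 * h)| * (tau p.2 : ℝ))) :=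
          (Finset.abs_sum_le_sum_abs _ _).trans (Finset.sum_le_sum hp)
      _ ≤ (A * (4 * Λ * ((l : ℝ) + 1)⁻¹)) * (F h * (2 * B)) := by
          rw [← Finset.mul_sum]
          refine mul_le_mul_of_nonneg_left ?_ (by positivity)
          exact sum_Shl_le hx.le hQ hh1 l (f := fun n => |a (n * h)| * (tau n : ℝ))
            (fun n => by positivity) (hered h hh1 hhx)
      _ = _ := by ring
  have hharm : ∀ h ∈ Finset.Icc 1 ⌊2 * x / Q⌋₊,
      ∑ l ∈ Finset.range (⌊2 * x / (Q * h)⌋₊ + 1), ((l : ℝ) + 1)⁻¹ ≤ 3 * Λ := by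
    intro h hh
    have h1 := harmonic_le_one_add_log (⌊2 * x / (Q * h)⌋₊ + 1)
    have h2 := log_le_two_mul_log_two_add ht (by positivity)
      (hfloor h (Finset.mem_Icc.mp hh).1 _ le_rfl).2
    rw [harmonic] at h1
    push_cast at h1
    linarith
  calc _ ≤ ∑ h ∈ Finset.Icc 1 ⌊2 * x / Q⌋₊, ∑ l ∈ Finset.range (⌊2 * x / (Q * h)⌋₊ + 1),
          8 * A * Λ * B * F h * ((l : ℝ) + 1)⁻¹ := by
        refine (Finset.abs_sum_le_sum_abs _ _).trans (Finset.sum_le_sum fun h hh => ?_)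
        exact (Finset.abs_sum_le_sum_abs _ _).trans (Finset.sum_le_sum (hterm h hh))
    _ ≤ ∑ h ∈ Finset.Icc 1 ⌊2 * x / Q⌋₊, 8 * A * Λ * B * F h * (3 * Λ) := by
        refine Finset.sum_le_sum fun h hh => ?_
        rw [← Finset.mul_sum]
        have := hF0 h
        exact mul_le_mul_of_nonneg_left (hharm h hh) (by positivity)
    _ = 24 * A * Λ ^ 2 * (B * ∑ h ∈ Finset.Icc 1 ⌊2 * x / Q⌋₊, F h) := by
        rw [← Finset.sum_mul, ← Finset.mul_sum]
        ring
    _ ≤ 24 * A * Λ ^ 2 * (S ^ 2 / K) := by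
        refine mul_le_mul_of_nonneg_left ?_ (by positivity)
        exact (mul_le_mul_of_nonneg_left hFT hB0).trans hBT
    _ = _ := by ring
end
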